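/- arXiv:1710.10018 — 2 statements merged into one kernel-verified Lean document; each statement's English description precedes it below -/
import Mathlib

section
/- Let R be a Noetherian local ring and X a resolving subcategory of finitely generated R-modules. If X contains an eventually periodic module M of finite positive Gorenstein dimension (i.e. Ω^n M ≅ Ω^{n+t} M for some n ≥ gd(M) and t > 0), then X has infinite radius. -/
open CategoryTheory

noncomputable section

namespace Paper

variable (R : Type) [CommRing R]

/-- finitely generated projective module (object of `add R`) -/
def FGProj (M : ModuleCat.{0} R) : Prop := Module.Finite R M ∧ Module.Projective R M

/-- a short exact sequence `0 → L → M → N → 0` -/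
def SES {L M N : ModuleCat.{0} R} (f : L →ₗ[R] M) (g : M →ₗ[R] N) : Prop :=
  Function.Injective f ∧ Function.Surjective g ∧ LinearMap.ker g = LinearMap.range f

/-- `N` is a first syzygy of `M`: kernel of a surjection from a f.g. projective onto `M`. -/
def IsSyzygy (N M : ModuleCat.{0} R) : Prop :=
  ∃ (P : ModuleCat.{0} R) (f : P →ₗ[R] M), FGProj R P ∧ Function.Surjective f ∧
    Nonempty (N ≃ₗ[R] LinearMap.ker f)

/-- `N` is an `n`-th syzygy of `M` -/
def IsNthSyzygy : ℕ → ModuleCat.{0} R → ModuleCat.{0} R → Prop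
  | 0, N, M => Nonempty (N ≃ₗ[R] M)
  | (n+1), N, M => ∃ K : ModuleCat.{0} R, IsNthSyzygy n K M ∧ IsSyzygy R N K

/-- `f : M → P` is a left `add R`-approximation -/
def IsLeftApprox {M P : ModuleCat.{0} R} (f : M →ₗ[R] P) : Prop :=
  FGProj R P ∧ ∀ (Q : ModuleCat.{0} R), FGProj R Q → ∀ g : M →ₗ[R] Q,
    ∃ h : P →ₗ[R] Q, h.comp f = g

/-- `N` is a first cosyzygy of `M`: cokernel of a left `add R`-approximation. -/
def IsCosyzygy (N M : ModuleCat.{0} R) : Prop :=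
  ∃ (P : ModuleCat.{0} R) (f : M →ₗ[R] P), IsLeftApprox R f ∧
    Nonempty (N ≃ₗ[R] (P ⧸ LinearMap.range f))

/-- `N` is an `n`-th cosyzygy of `M` -/
def IsNthCosyzygy : ℕ → ModuleCat.{0} R → ModuleCat.{0} R → Prop
  | 0, N, M => Nonempty (N ≃ₗ[R] M)
  | (n+1), N, M => ∃ K : ModuleCat.{0} R, IsNthCosyzygy n K M ∧ IsCosyzygy R N K

/-- `T` is an (Auslander) transpose of `M` -/
def IsTranspose (T M : ModuleCat.{0} R) : Prop :=
  ∃ (P₁ P₀ : ModuleCat.{0} R) (d : P₁ →ₗ[R] P₀) (p : P₀ →ₗ[R] M),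
    FGProj R P₁ ∧ FGProj R P₀ ∧ Function.Surjective p ∧
    LinearMap.ker p = LinearMap.range d ∧
    Nonempty (T ≃ₗ[R] ((Module.Dual R P₁) ⧸ LinearMap.range d.dualMap))

/-- stably isomorphic: `M ⊕ P ≅ N ⊕ Q` with `P`, `Q` f.g. projective -/
def StablyIso (M N : ModuleCat.{0} R) : Prop :=
  ∃ P Q : ModuleCat.{0} R, FGProj R P ∧ FGProj R Q ∧
    Nonempty ((M × P) ≃ₗ[R] (N × Q))

/-- resolving subcategory of `mod R` -/
structure Resolving (X : ModuleCat.{0} R → Prop) : Prop where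
  fg : ∀ M, X M → Module.Finite R M
  proj : ∀ M : ModuleCat.{0} R, FGProj R M → X M
  summand : ∀ M N N' : ModuleCat.{0} R, X M → Nonempty (M ≃ₗ[R] N × N') → X N
  extension : ∀ (L M N : ModuleCat.{0} R) (f : L →ₗ[R] M) (g : M →ₗ[R] N),
      SES R f g → X L → X N → X M
  ker_epi : ∀ (L M N : ModuleCat.{0} R) (f : L →ₗ[R] M) (g : M →ₗ[R] N),
      SES R f g → X M → X N → X L

/-- `Ext^i_R(M, N) = 0` -/
def ExtVanish (M N : ModuleCat.{0} R) (i : ℕ) : Prop :=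
  Subsingleton (((Ext R (ModuleCat.{0} R) i).obj (Opposite.op M)).obj N)

/-- totally reflexive (Gorenstein dimension zero) module -/
def TotallyReflexive (M : ModuleCat.{0} R) : Prop :=
  Function.Bijective (Module.Dual.eval R M) ∧
  ∀ i : ℕ, 0 < i → ExtVanish R M (ModuleCat.of R R) i ∧
    ExtVanish R (ModuleCat.of R (Module.Dual R M)) (ModuleCat.of R R) i

/-- `M` has finite projective dimension -/
def FiniteProjDim (M : ModuleCat.{0} R) : Prop :=
  ∃ (n : ℕ) (N : ModuleCat.{0} R), IsNthSyzygy R n N M ∧ FGProj R N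

/-- additive closure of a family of modules -/
def AddClosure (S : ModuleCat.{0} R → Prop) (M : ModuleCat.{0} R) : Prop :=
  ∃ (k : ℕ) (f : Fin k → ModuleCat.{0} R) (N : ModuleCat.{0} R),
    (∀ i, S (f i)) ∧ Nonempty ((M × N) ≃ₗ[R] ((i : Fin k) → f i))

/-- the operation `[−]`: `add` closure of `R` and all syzygies of modules of `Y` -/
def Bracket (Y : ModuleCat.{0} R → Prop) : ModuleCat.{0} R → Prop :=
  AddClosure R (fun N => FGProj R N ∨ ∃ (M : ModuleCat.{0} R) (i : ℕ), Y M ∧ IsNthSyzygy R i N M)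

/-- `Y ∘ Z`: extensions of a module of `Z` by a module of `Y` -/
def ExtOf (Y Z : ModuleCat.{0} R → Prop) (M : ModuleCat.{0} R) : Prop :=
  ∃ (A B : ModuleCat.{0} R) (f : A →ₗ[R] M) (g : M →ₗ[R] B), Y A ∧ Z B ∧ SES R f g

/-- the ball `[C]_n` of radius `n` centered at `C` -/
def Ball (C : ModuleCat.{0} R) : ℕ → ModuleCat.{0} R → Prop
  | 0 => fun _ => False
  | 1 => Bracket R (fun M => Nonempty (M ≃ₗ[R] C))
  | (n+2) => Bracket R (ExtOf R (Ball C (n+1)) (Bracket R (fun M => Nonempty (M ≃ₗ[R] C))))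

/-- `X` has finite radius: `X ⊆ [C]_{n+1}` for some `C ∈ X`. -/
def FiniteRadius (X : ModuleCat.{0} R → Prop) : Prop :=
  ∃ (C : ModuleCat.{0} R) (n : ℕ), X C ∧ ∀ M, X M → Ball R C (n + 1) M

/-- `depth_A M ≥ n`: there is a weakly `M`-regular sequence of length `n` in the maximal ideal -/
def DepthGE (A : Type) [CommRing A] [IsLocalRing A]
    (M : Type) [AddCommGroup M] [Module A M] (n : ℕ) : Prop :=
  ∃ rs : List A, rs.length = n ∧ (∀ x ∈ rs, x ∈ IsLocalRing.maximalIdeal A) ∧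
    RingTheory.Sequence.IsWeaklyRegular M rs

/-- `M` is free at the prime `p` -/
def FreeAt (M : ModuleCat.{0} R) (p : PrimeSpectrum R) : Prop :=
  Module.Free (Localization.AtPrime p.asIdeal) (LocalizedModule p.asIdeal.primeCompl M)

/-- locally free on the punctured spectrum of a local ring -/
def LocFreeOnPunctured [IsLocalRing R] (M : ModuleCat.{0} R) : Prop :=
  ∀ p : PrimeSpectrum R, p.asIdeal ≠ IsLocalRing.maximalIdeal R → FreeAt R M p

/-- a Gorenstein local ring: `R` has finite injective dimension over itself -/
def Gorenstein : Prop :=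
  ∃ n : ℕ, ∀ i : ℕ, n < i → ∀ M : ModuleCat.{0} R, ExtVanish R M (ModuleCat.of R R) i

/-- the annihilator of the `i`-th local cohomology module `H^i_I(M)` -/
def aa (I : Ideal R) (i : ℕ) (M : ModuleCat.{0} R) : Ideal R :=
  Module.annihilator R ((localCohomology I i).obj M)

/-- an Ulrich module over a CM local ring of dimension `d` -/
def Ulrich [IsLocalRing R] (d : ℕ) (U : ModuleCat.{0} R) : Prop :=
  Module.Finite R U ∧ DepthGE R U d ∧ ¬ Subsingleton U ∧
  ∃ xs : List R, xs.length = d ∧ (∀ x ∈ xs, x ∈ IsLocalRing.maximalIdeal R) ∧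
    RingTheory.Sequence.IsWeaklyRegular U xs ∧
    (IsLocalRing.maximalIdeal R) • (⊤ : Submodule R U) = Ideal.ofList xs • ⊤

end Paper

open Paper

namespace Paper
section ExtPart
variable {R : Type} [CommRing R]

lemma extVanish_iff_res {M : ModuleCat.{0} R} (Pr : ProjectiveResolution M) (N : ModuleCat.{0} R)
    (i : ℕ) : ExtVanish R M N (i+1) ↔ ∀ f : Pr.complex.X (i+1) ⟶ N,
      Pr.complex.d (i+2) (i+1) ≫ f = 0 → ∃ h : Pr.complex.X i ⟶ N, Pr.complex.d (i+1) i ≫ h = f := by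
  have e := Pr.isoExt (R := R) (i+1) N
  have h1 : ExtVanish R M N (i+1) ↔
      Limits.IsZero ((Pr.complex.linearYonedaObj R N).homology (i+1)) := by
    unfold ExtVanish
    rw [← ModuleCat.isZero_iff_subsingleton]
    exact e.isZero_iff
  rw [h1, ← HomologicalComplex.exactAt_iff_isZero_homology,
    HomologicalComplex.exactAt_iff' _ i (i+1) (i+2) (by simp) (by simp),
    ShortComplex.moduleCat_exact_iff]
  rfl

lemma ext_iff_res {M : ModuleCat.{0} R} (Pr : ProjectiveResolution M) (N : ModuleCat.{0} R)
    (i : ℕ) : Subsingleton (Abelian.Ext M N (i+1)) ↔ ∀ f : Pr.complex.X (i+1) ⟶ N,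
      Pr.complex.d (i+2) (i+1) ≫ f = 0 → ∃ h : Pr.complex.X i ⟶ N, Pr.complex.d (i+1) i ≫ h = f := by
  constructor
  · intro h f hf
    exact (Pr.extMk_eq_zero_iff f (i+2) rfl hf i rfl).1 (Subsingleton.elim _ _)
  · intro h
    refine subsingleton_of_forall_eq 0 fun α => ?_
    obtain ⟨f, hf, rfl⟩ := Pr.extMk_surjective α (i+2) rfl
    exact (Pr.extMk_eq_zero_iff f (i+2) rfl hf i rfl).2 (h f hf)

lemma extVanish_iff (M N : ModuleCat.{0} R) (i : ℕ) :
    ExtVanish R M N (i+1) ↔ Subsingleton (Abelian.Ext M N (i+1)) := by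
  rw [extVanish_iff_res (ProjectiveResolution.of M), ext_iff_res (ProjectiveResolution.of M)]

lemma ses_shortExact {L M N : ModuleCat.{0} R} {f : L →ₗ[R] M} {g : M →ₗ[R] N}
    (h : SES R f g) : ∃ w, (ShortComplex.mk (ModuleCat.ofHom f) (ModuleCat.ofHom g) w).ShortExact := by
  obtain ⟨h1, h2, h3⟩ := h
  have w : ModuleCat.ofHom f ≫ ModuleCat.ofHom g = 0 := by
    ext x
    have : f x ∈ LinearMap.ker g := h3 ▸ ⟨x, rfl⟩
    simpa using this
  refine ⟨w, ?_⟩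
  refine { exact := ?_, mono_f := ?_, epi_g := ?_ }
  · rw [ShortComplex.moduleCat_exact_iff]
    intro x hx
    have : x ∈ LinearMap.range f := h3 ▸ hx
    exact this
  · exact (ModuleCat.mono_iff_injective _).2 h1
  · exact (ModuleCat.epi_iff_surjective _).2 h2

/-- dimension shift -/
lemma extVanish_shift {L P N : ModuleCat.{0} R} {f : L →ₗ[R] P} {g : P →ₗ[R] N}
    (h : SES R f g) (hP : Module.Projective R P) (Y : ModuleCat.{0} R) (i : ℕ) :
    ExtVanish R N Y (i+2) ↔ ExtVanish R L Y (i+1) := by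
  rw [extVanish_iff L Y i, extVanish_iff N Y (i+1)]
  obtain ⟨w, hS⟩ := ses_shortExact h
  have hP' : Projective P := (IsProjective.iff_projective P).1 hP
  constructor
  · intro hh
    refine subsingleton_of_forall_eq 0 fun α => ?_
    obtain ⟨x, hx⟩ := Abelian.Ext.contravariant_sequence_exact₁ hS Y α (n₁ := i+2) (by omega)
      (Subsingleton.elim _ _)
    rw [← hx, Abelian.Ext.eq_zero_of_projective x]
    simp
  · intro hh
    refine subsingleton_of_forall_eq 0 fun α => ?_
    obtain ⟨x, hx⟩ := Abelian.Ext.contravariant_sequence_exact₃ hS Y α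
      (Abelian.Ext.eq_zero_of_projective (n := i+1) (P := P) _) (n₀ := i+1) (by omega)
    rw [← hx, Subsingleton.elim x 0]
    simp

lemma extVanish_one {L P N : ModuleCat.{0} R} {f : L →ₗ[R] P} {g : P →ₗ[R] N}
    (h : SES R f g) (hP : Module.Projective R P) (Y : ModuleCat.{0} R) :
    ExtVanish R N Y 1 ↔ ∀ a : L →ₗ[R] Y, ∃ b : P →ₗ[R] Y, b.comp f = a := by
  rw [extVanish_iff N Y 0]
  obtain ⟨w, hS⟩ := ses_shortExact h
  have hP' : Projective P := (IsProjective.iff_projective P).1 hP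
  constructor
  · intro hh a
    obtain ⟨x, hx⟩ := Abelian.Ext.contravariant_sequence_exact₁ hS Y
      (Abelian.Ext.mk₀ (ModuleCat.ofHom a)) (n₁ := 1) (by omega)
      (Subsingleton.elim (α := Abelian.Ext N Y (0+1)) _ _)
    obtain ⟨b, rfl⟩ := (Abelian.Ext.mk₀_bijective _ _).2 x
    rw [Abelian.Ext.mk₀_comp_mk₀] at hx
    refine ⟨b.hom, ?_⟩
    have := (Abelian.Ext.mk₀_bijective _ _).1 hx
    simpa using congrArg ModuleCat.Hom.hom this
  · intro hh
    refine subsingleton_of_forall_eq 0 fun α => ?_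
    obtain ⟨x, hx⟩ := Abelian.Ext.contravariant_sequence_exact₃ hS Y α
      (Abelian.Ext.eq_zero_of_projective (n := 0) (P := P) _) (n₀ := 0) (by omega)
    obtain ⟨a, rfl⟩ := (Abelian.Ext.mk₀_bijective _ _).2 x
    obtain ⟨b, hb⟩ := hh a.hom
    have : a = ModuleCat.ofHom f ≫ ModuleCat.ofHom b := by
      ext y
      exact (LinearMap.congr_fun hb y).symm
    rw [← hx, this, ← Abelian.Ext.mk₀_comp_mk₀]
    exact hS.extClass_comp_assoc _

end ExtPart
end Paper


lemma LinearMap.exists_extend_of_surj {R A B C : Type*} [CommRing R] [AddCommGroup A] [Module R A]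
    [AddCommGroup B] [Module R B] [AddCommGroup C] [Module R C] (g : A →ₗ[R] B)
    (hg : Function.Surjective g) (φ : A →ₗ[R] C) (h : LinearMap.ker g ≤ LinearMap.ker φ) :
    ∃ ψ : B →ₗ[R] C, ψ.comp g = φ := by
  refine ⟨((LinearMap.ker g).liftQ φ h).comp (g.quotKerEquivOfSurjective hg).symm.toLinearMap, ?_⟩
  ext x
  simp only [LinearMap.comp_apply, LinearEquiv.coe_coe]
  have : (g.quotKerEquivOfSurjective hg).symm (g x) = Submodule.Quotient.mk x := by
    rw [LinearEquiv.symm_apply_eq]; simp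
  rw [this]; simp


namespace Paper
section TRPart
variable {R : Type} [CommRing R]

lemma tr_of_extend {G P K : ModuleCat.{0} R} {f : G →ₗ[R] P} {g : P →ₗ[R] K}
    (h : SES R f g) (hP : FGProj R P) (hG : TotallyReflexive R G)
    (hext : ∀ a : G →ₗ[R] R, ∃ b : P →ₗ[R] R, b.comp f = a) : TotallyReflexive R K := by
  obtain ⟨hPf, hPp⟩ := hP
  have h' := h
  obtain ⟨hf, hg, hfg⟩ := h'
  have hgf : ∀ x, g (f x) = 0 := fun x => by
    have : f x ∈ LinearMap.ker g := hfg ▸ ⟨x, rfl⟩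
    simpa using this
  have hdual : SES R (L := ModuleCat.of R (Module.Dual R K)) (M := ModuleCat.of R (Module.Dual R P))
      (N := ModuleCat.of R (Module.Dual R G)) g.dualMap f.dualMap := by
    refine ⟨LinearMap.dualMap_injective_of_surjective hg, fun a => ?_, ?_⟩
    · obtain ⟨b, hb⟩ := hext a
      exact ⟨b, hb⟩
    · ext φ
      constructor
      · intro hφ
        have hφ' : LinearMap.ker g ≤ LinearMap.ker φ := by
          rw [hfg]
          rintro _ ⟨x, rfl⟩
          exact LinearMap.congr_fun (LinearMap.mem_ker.1 hφ) x
        obtain ⟨ψ, hψ⟩ := (LinearMap.exists_extend_of_surj g hg φ hφ')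
        exact ⟨ψ, hψ⟩
      · rintro ⟨ψ, rfl⟩
        rw [LinearMap.mem_ker]
        ext x
        show ψ (g (f x)) = 0
        rw [hgf, map_zero]
  have hPd : Module.Projective R (Module.Dual R P) := inferInstance
  have hKd : ∀ i : ℕ, 0 < i → ExtVanish R (ModuleCat.of R (Module.Dual R K)) (ModuleCat.of R R) i := by
    intro i hi
    obtain ⟨j, rfl⟩ : ∃ j, i = j + 1 := ⟨i - 1, by omega⟩
    exact (extVanish_shift hdual hPd _ j).1 (hG.2 (j+2) (by omega)).2
  have hKe : ∀ i : ℕ, 0 < i → ExtVanish R K (ModuleCat.of R R) i := by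
    intro i hi
    rcases i with _ | _ | j
    · omega
    · exact (extVanish_one h hPp _).2 hext
    · exact (extVanish_shift h hPp _ j).2 (hG.2 (j+1) (by omega)).1
  have hPr : Function.Bijective (Module.Dual.eval R P) := Module.bijective_dual_eval R P
  refine ⟨⟨?_, ?_⟩, fun i hi => ⟨hKe i hi, hKd i hi⟩⟩
  · rw [injective_iff_map_eq_zero]
    intro k hk
    obtain ⟨p, rfl⟩ := hg k
    have h1 : LinearMap.ker f.dualMap ≤ LinearMap.ker (Module.Dual.eval R P p) := by
      have := hdual.2.2
      rw [this]
      rintro _ ⟨ψ, rfl⟩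
      exact LinearMap.congr_fun hk ψ
    obtain ⟨ξ, hξ⟩ := LinearMap.exists_extend_of_surj (f.dualMap) hdual.2.1 _ h1
    obtain ⟨x, rfl⟩ := hG.1.2 ξ
    have : p = f x := by
      apply hPr.1
      rw [← hξ]
      rfl
    rw [this, hgf]
  · intro ξ
    obtain ⟨η, hη⟩ := (extVanish_one hdual hPd (ModuleCat.of R R)).1 (hG.2 1 one_pos).2 ξ
    obtain ⟨p, rfl⟩ := hPr.2 η
    exact ⟨g p, hη⟩

end TRPart
end Paper


namespace Paper
section Koszul
set_option linter.unusedSectionVars false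

/-- action of a matrix over `R` on vectors with entries in an `R`-module -/
def act {R : Type} [CommRing R] {α β : Type} [Fintype β] (A : Matrix α β R)
    {M : Type} [AddCommGroup M] [Module R M] (z : β → M) : α → M := fun a => ∑ b, A a b • z b

variable {R : Type} [CommRing R]
variable {α β γ : Type} [Fintype α] [Fintype β] [Fintype γ]
variable {M N L : Type} [AddCommGroup M] [Module R M] [AddCommGroup N] [Module R N]
  [AddCommGroup L] [Module R L]

lemma act_add (A : Matrix α β R) (z w : β → M) : act A (z + w) = act A z + act A w := by
  ext a; simp [act, Finset.sum_add_distrib]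

lemma act_zero (A : Matrix α β R) : act A (0 : β → M) = 0 := by
  ext a; simp [act]

lemma act_neg (A : Matrix α β R) (z : β → M) : act A (-z) = -act A z := by
  ext a; simp [act]

lemma act_sub (A : Matrix α β R) (z w : β → M) : act A (z - w) = act A z - act A w := by
  ext a; simp [act, smul_sub]

lemma act_smul (A : Matrix α β R) (s : R) (z : β → M) : act A (s • z) = s • act A z := by
  ext a
  simp only [act, Pi.smul_apply, Finset.smul_sum]
  exact Finset.sum_congr rfl fun b _ => smul_comm _ _ _

lemma act_act (A : Matrix α β R) (B : Matrix β γ R) (z : γ → M) :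
    act A (act B z) = act (A * B) z := by
  ext a
  simp only [act, Matrix.mul_apply, Finset.smul_sum, Finset.sum_smul, smul_smul]
  exact Finset.sum_comm

lemma act_map (A : Matrix α β R) (f : M →ₗ[R] N) (z : β → M) :
    act A (fun b => f (z b)) = fun a => f (act A z a) := by
  ext a; simp [act]

/-- a complex of finite free modules given by matrices -/
structure MC (R : Type) [CommRing R] where
  ι : ℕ → Type
  fin : ∀ n, Fintype (ι n)
  dec : ∀ n, DecidableEq (ι n)
  d : ∀ n, Matrix (ι (n+1)) (ι n) R
  dd : ∀ n, d (n+1) * d n = 0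

attribute [instance] MC.fin MC.dec

/-- `s` kills the cohomology at spot `n` with coefficients in `M` -/
def Kill (K : MC R) : ℕ → R → (M : Type) → [AddCommGroup M] → [Module R M] → Prop
  | 0, _, _, _, _ => True
  | (n+1), s, M, _, _ => ∀ z : K.ι (n+1) → M, act (K.d (n+1)) z = 0 →
      ∃ y : K.ι n → M, act (K.d n) y = s • z

lemma Kill.mul {K : MC R} {n : ℕ} {s : R} (h : Kill K n s M) (r : R) : Kill K n (r * s) M := by
  cases n with
  | zero => trivial
  | succ n =>
    intro z hz
    obtain ⟨y, hy⟩ := h z hz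
    exact ⟨r • y, by rw [act_smul, hy, mul_smul]⟩

lemma Kill.mul' {K : MC R} {n : ℕ} {s : R} (h : Kill K n s M) (r : R) : Kill K n (s * r) M := by
  rw [mul_comm]; exact h.mul r

lemma Kill.add {K : MC R} {n : ℕ} {s r : R} (h : Kill K n s M) (h' : Kill K n r M) :
    Kill K n (s + r) M := by
  cases n with
  | zero => trivial
  | succ n =>
    intro z hz
    obtain ⟨y, hy⟩ := h z hz
    obtain ⟨y', hy'⟩ := h' z hz
    exact ⟨y + y', by rw [act_add, hy, hy', add_smul]⟩

lemma Kill.zero (K : MC R) (n : ℕ) : Kill K n 0 M := by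
  cases n with
  | zero => trivial
  | succ n => exact fun z _ => ⟨0, by rw [act_zero, zero_smul]⟩

lemma kill_of_smul (K : MC R) (n : ℕ) (s : R) (h : ∀ x : M, s • x = 0) : Kill K n s M := by
  cases n with
  | zero => trivial
  | succ n => exact fun z _ => ⟨0, by rw [act_zero]; ext b; simp [h]⟩

/-- the ideal of killers -/
def killIdeal (K : MC R) (n : ℕ) (M : Type) [AddCommGroup M] [Module R M] : Ideal R where
  carrier := {s | Kill K n s M}
  add_mem' := Kill.add
  zero_mem' := Kill.zero K n
  smul_mem' := fun r _ h => Kill.mul h r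

lemma Kill.retract {K : MC R} {n : ℕ} {s : R} (i : N →ₗ[R] M) (r : M →ₗ[R] N)
    (hri : ∀ x, r (i x) = x) (h : Kill K n s M) : Kill K n s N := by
  cases n with
  | zero => trivial
  | succ n =>
    intro z hz
    obtain ⟨y, hy⟩ := h (fun b => i (z b)) (by rw [act_map, hz]; ext; simp)
    refine ⟨fun b => r (y b), ?_⟩
    rw [act_map, hy]
    ext b; simp [hri]

lemma Kill.equiv {K : MC R} {n : ℕ} {s : R} (e : M ≃ₗ[R] N) (h : Kill K n s M) : Kill K n s N :=
  h.retract e.symm.toLinearMap e.toLinearMap (by simp)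

lemma Kill.pi {K : MC R} {n : ℕ} {s : R} {κ : Type} {F : κ → Type} [∀ j, AddCommGroup (F j)]
    [∀ j, Module R (F j)] (h : ∀ j, Kill K n s (F j)) : Kill K n s ((j : κ) → F j) := by
  cases n with
  | zero => trivial
  | succ n =>
    intro z hz
    have : ∀ j, ∃ y : K.ι n → F j, act (K.d n) y = s • (fun b => z b j) := by
      intro j
      refine h j _ ?_
      have := act_map (K.d (n+1)) (LinearMap.proj j : ((j : κ) → F j) →ₗ[R] F j) z
      simp only [LinearMap.proj_apply] at this
      rw [this, hz]; rfl
    choose y hy using this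
    refine ⟨fun b j => y j b, ?_⟩
    ext b j
    have := congrFun (hy j) b
    simpa [act, Finset.sum_apply] using this

section ses

lemma kill_mid
    (f : L →ₗ[R] M) (g : M →ₗ[R] N) (hf : Function.Injective f) (hg : Function.Surjective g)
    (hfg : ∀ x, g x = 0 ↔ ∃ y, f y = x)
    {K : MC R} {n : ℕ} {s s' : R} (h : Kill K n s L) (h' : Kill K n s' N) :
    Kill K n (s * s') M := by
  cases n with
  | zero => trivial
  | succ n =>
    intro z hz
    obtain ⟨y, hy⟩ := h' (fun b => g (z b)) (by rw [act_map, hz]; ext; simp)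
    choose w hw using fun b => hg (y b)
    obtain rfl : (fun b => g (w b)) = y := funext hw
    have h1 : ∀ b, ∃ v, f v = (s' • z - act (K.d n) w) b := by
      intro b
      rw [← hfg]
      rw [act_map] at hy
      have := congrFun hy b
      simp only [Pi.smul_apply] at this
      simp [this]
    choose v hv using h1
    have hv' : (fun b => f (v b)) = s' • z - act (K.d n) w := funext hv
    obtain ⟨u, hu⟩ := h v (by
      ext a
      apply hf
      have := act_map (K.d (n+1)) f v
      rw [hv', act_sub, act_smul, hz, act_act, K.dd] at this
      have := congrFun this a
      simpa [act] using this.symm)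
    refine ⟨s • w + (fun b => f (u b)), ?_⟩
    rw [act_add, act_smul, act_map, hu]
    ext b
    have := hv b
    simp only [Pi.add_apply, Pi.smul_apply, map_smul, this, Pi.sub_apply, smul_sub, smul_smul]
    abel

lemma kill_left
    (f : L →ₗ[R] M) (g : M →ₗ[R] N) (hf : Function.Injective f) (hg : Function.Surjective g)
    (hfg : ∀ x, g x = 0 ↔ ∃ y, f y = x)
    {K : MC R} (hK : IsEmpty (K.ι 0)) {n : ℕ} {s s' : R} (h : Kill K n s N)
    (h' : Kill K (n+1) s' M) : Kill K (n+1) (s * s') L := by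
  intro z hz
  obtain ⟨y, hy⟩ := h' (fun b => f (z b)) (by rw [act_map, hz]; ext; simp)
  have key : ∃ v : K.ι n → L, act (K.d n) (fun b => f (v b)) = s • act (K.d n) y := by
    cases n with
    | zero =>
      refine ⟨fun b => hK.elim b, ?_⟩
      rw [← act_smul]
      congr 1
      ext b; exact hK.elim b
    | succ n =>
      obtain ⟨w', hw'⟩ := h (fun b => g (y b)) (by
        rw [act_map, hy]
        ext b
        have : g (f (z b)) = 0 := (hfg _).2 ⟨_, rfl⟩
        simp [this])
      choose w hw using fun b => hg (w' b)
      obtain rfl : (fun b => g (w b)) = w' := funext hw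
      rw [act_map] at hw'
      have h1 : ∀ b, ∃ v, f v = (s • y - act (K.d n) w) b := by
        intro b
        rw [← hfg]
        have := congrFun hw' b
        simp only [Pi.smul_apply] at this
        simp [this]
      choose v hv using h1
      have hv' : (fun b => f (v b)) = s • y - act (K.d n) w := funext hv
      refine ⟨v, ?_⟩
      rw [hv', act_sub, act_smul, act_act, K.dd]
      ext; simp [act]
  obtain ⟨v, hv⟩ := key
  refine ⟨v, ?_⟩
  ext b
  apply hf
  rw [act_map, hy] at hv
  have := congrFun hv b
  simpa [mul_smul] using this

/-- if `f` is zero on cohomology at spot `n+1` then killers at spot `n` of the cokernel kill. -/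
lemma kill_conn
    (f : L →ₗ[R] M) (g : M →ₗ[R] N) (hf : Function.Injective f) (hg : Function.Surjective g)
    (hfg : ∀ x, g x = 0 ↔ ∃ y, f y = x)
    {K : MC R} (hK : IsEmpty (K.ι 0)) {n : ℕ} {s : R} (h : Kill K n s N)
    (h' : ∀ z : K.ι (n+1) → L, act (K.d (n+1)) z = 0 →
      ∃ y : K.ι n → M, act (K.d n) y = fun b => f (z b)) : Kill K (n+1) s L := by
  intro z hz
  obtain ⟨y, hy⟩ := h' z hz
  have key : ∃ v : K.ι n → L, act (K.d n) (fun b => f (v b)) = s • act (K.d n) y := by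
    cases n with
    | zero =>
      refine ⟨fun b => hK.elim b, ?_⟩
      rw [← act_smul]
      congr 1
      ext b; exact hK.elim b
    | succ n =>
      obtain ⟨w', hw'⟩ := h (fun b => g (y b)) (by
        rw [act_map, hy]
        ext b
        exact (hfg _).2 ⟨_, rfl⟩)
      choose w hw using fun b => hg (w' b)
      obtain rfl : (fun b => g (w b)) = w' := funext hw
      rw [act_map] at hw'
      have h1 : ∀ b, ∃ v, f v = (s • y - act (K.d n) w) b := by
        intro b
        rw [← hfg]
        have := congrFun hw' b
        simp only [Pi.smul_apply] at this
        simp [this]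
      choose v hv using h1
      have hv' : (fun b => f (v b)) = s • y - act (K.d n) w := funext hv
      refine ⟨v, ?_⟩
      rw [hv', act_sub, act_smul, act_act, K.dd]
      ext; simp [act]
  obtain ⟨v, hv⟩ := key
  refine ⟨v, ?_⟩
  ext b
  apply hf
  rw [act_map, hy] at hv
  have := congrFun hv b
  simpa using this

end ses

/-- base complex: `R` placed in spot `p` -/
def baseMC (R : Type) [CommRing R] (p : ℕ) : MC R where
  ι n := {_u : Unit // n = p}
  fin _ := inferInstance
  dec _ := inferInstance
  d _ := 0
  dd _ := by simp

/-- cone of multiplication by `x` -/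
def coneMC (x : R) (K : MC R) : MC R where
  ι n := K.ι (n+1) ⊕ K.ι n
  fin _ := inferInstance
  dec _ := inferInstance
  d n := Matrix.fromBlocks (K.d (n+1)) 0 (x • (1 : Matrix (K.ι (n+1)) (K.ι (n+1)) R)) (-(K.d n))
  dd n := by
    rw [Matrix.fromBlocks_multiply]
    simp [K.dd]

/-- Koszul complex -/
def kosz (p : ℕ) : List R → MC R
  | [] => baseMC R p
  | (x :: l) => coneMC x (kosz p l)

lemma act_cone (x : R) (K : MC R) (n : ℕ) (a : K.ι (n+1) → M) (b : K.ι n → M) :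
    act ((coneMC x K).d n) (Sum.elim a b : (coneMC x K).ι n → M) =
      (Sum.elim (act (K.d (n+1)) a) (x • a - act (K.d n) b) : (coneMC x K).ι (n+1) → M) := by
  ext c
  refine (Fintype.sum_sum_type (α₁ := K.ι (n+1)) (α₂ := K.ι n)
    (fun e => (coneMC x K).d n c e • (Sum.elim a b : K.ι (n+1) ⊕ K.ι n → M) e)).trans ?_
  rcases c with c | c
  · simp [coneMC, act]
  · simp [coneMC, act, Matrix.one_apply, ite_smul, sub_eq_add_neg]

lemma cone_cycle (x : R) (K : MC R) (n : ℕ) (z : (coneMC x K).ι n → M)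
    (hz : act ((coneMC x K).d n) z = 0) : ∃ (a : K.ι (n+1) → M) (b : K.ι n → M),
      z = Sum.elim a b ∧ act (K.d (n+1)) a = 0 ∧ act (K.d n) b = x • a := by
  refine ⟨fun c => z (Sum.inl c), fun c => z (Sum.inr c), ?_, ?_⟩
  · ext c; rcases c with c | c <;> rfl
  · have hz' : z = (Sum.elim (fun c => z (Sum.inl c)) (fun c => z (Sum.inr c)) :
      (coneMC x K).ι n → M) := by
      ext c; rcases c with c | c <;> rfl
    rw [hz', act_cone] at hz
    constructor
    · ext c
      exact congrFun hz (Sum.inl c)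
    · ext c
      have := congrFun hz (Sum.inr c)
      simp only [Sum.elim_inr, Pi.sub_apply] at this
      exact (sub_eq_zero.1 this).symm

lemma cone_kill_self (x : R) (K : MC R) (n : ℕ) : Kill (coneMC x K) n x M := by
  cases n with
  | zero => trivial
  | succ n =>
    intro z hz
    obtain ⟨a, b, rfl, ha, hb⟩ := cone_cycle x K (n+1) z hz
    refine ⟨Sum.elim b 0, ?_⟩
    rw [act_cone, act_zero, hb, sub_zero]
    ext c; rcases c with c | c <;> rfl

lemma cone_kill_other (x y : R) (K : MC R) (h : ∀ n, Kill K n y M) (n : ℕ) :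
    Kill (coneMC x K) n (y * y) M := by
  cases n with
  | zero => trivial
  | succ n =>
    intro z hz
    obtain ⟨a, b, rfl, ha, hb⟩ := cone_cycle x K (n+1) z hz
    obtain ⟨c, hc⟩ := h (n+2) a ha
    obtain ⟨w, hw⟩ := h (n+1) (y • b - x • c) (by
      rw [act_sub, act_smul, act_smul, hb, hc, smul_comm, sub_self])
    refine ⟨Sum.elim (y • c) (-w), ?_⟩
    rw [act_cone, act_smul, hc, act_neg, hw]
    ext c'
    rcases c' with c' | c'
    · exact (mul_smul y y _).symm
    · change x • y • c c' - -(y • (y • b c' - x • c c')) = (y * y) • b c'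
      rw [smul_comm x y, mul_smul, smul_sub]; abel

lemma kosz_kill (p : ℕ) (l : List R) (x : R) (hx : x ∈ l) :
    ∃ c : ℕ, ∀ n, Kill (kosz p l) n (x ^ c) M := by
  induction l with
  | nil => simp at hx
  | cons y l ih =>
    rcases List.mem_cons.1 hx with rfl | h
    · exact ⟨1, fun n => by rw [pow_one]; exact cone_kill_self _ _ _⟩
    · obtain ⟨c, hc⟩ := ih h
      refine ⟨c + c, fun n => ?_⟩
      rw [pow_add]
      exact cone_kill_other _ _ _ hc n

lemma kosz_empty_low (p : ℕ) (l : List R) (n : ℕ) (h : n + l.length < p) :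
    IsEmpty ((kosz p l).ι n) := by
  induction l generalizing n with
  | nil => exact ⟨fun ⟨_, h'⟩ => by simp at h; omega⟩
  | cons y l ih =>
    simp only [List.length_cons] at h
    have h1 := ih (n+1) (by omega)
    have h2 := ih n (by omega)
    exact ⟨fun c => by rcases c with c | c; exacts [h1.elim c, h2.elim c]⟩

lemma kosz_empty_high (p : ℕ) (l : List R) (n : ℕ) (h : p < n) :
    IsEmpty ((kosz p l).ι n) := by
  induction l generalizing n with
  | nil => exact ⟨fun ⟨_, h'⟩ => by omega⟩
  | cons y l ih =>
    have h1 := ih (n+1) (by omega)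
    have h2 := ih n (by omega)
    exact ⟨fun c => by rcases c with c | c; exacts [h1.elim c, h2.elim c]⟩

lemma kosz_top (q : ℕ) (l : List R) : ∃ τ : (kosz (q+1) l).ι (q+1), ∀ b,
    (kosz (q+1) l).d q τ b ∈ Ideal.ofList l := by
  induction l with
  | nil => exact ⟨⟨(), rfl⟩, fun b => zero_mem (Ideal.ofList ([] : List R))⟩
  | cons x l ih =>
    obtain ⟨τ, hτ⟩ := ih
    refine ⟨Sum.inr τ, fun b => ?_⟩
    rw [Ideal.ofList_cons]
    rcases b with b | b
    · refine Ideal.mem_sup_left ?_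
      simp only [kosz, coneMC, Matrix.fromBlocks_apply₂₁, Matrix.smul_apply, smul_eq_mul]
      exact Ideal.mul_mem_right _ _ (Ideal.mem_span_singleton_self x)
    · refine Ideal.mem_sup_right ?_
      simp only [kosz, coneMC, Matrix.fromBlocks_apply₂₂, Matrix.neg_apply]
      exact neg_mem (hτ b)

lemma kosz_top_kill (q : ℕ) (l : List R) (s : R) (h : Kill (kosz (q+1) l) (q+1) s R) :
    s ∈ Ideal.ofList l := by
  obtain ⟨τ, hτ⟩ := kosz_top q l
  have he := kosz_empty_high (q+1) l (q+2) (by omega)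
  obtain ⟨y, hy⟩ := h (Pi.single τ 1) (by ext a; exact he.elim a)
  have := congrFun hy τ
  simp only [act, Pi.smul_apply, Pi.single_eq_same, smul_eq_mul, mul_one] at this
  rw [← this]
  exact Ideal.sum_mem _ fun b _ => Ideal.mul_mem_right _ _ (hτ b)

end Koszul
end Paper


namespace Paper
section PKsec
variable {R : Type} [CommRing R]

/-- uniform killers outside `P` -/
def PK (K : ℕ → MC R) (P : Ideal R) (i : ℕ) (N : Type) [AddCommGroup N] [Module R N] : Prop :=
  ∃ s, s ∉ P ∧ ∀ k, Kill (K k) i s N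

lemma PK.collect {K : ℕ → MC R} {P : Ideal R} [P.IsPrime] {t : ℕ} {N : Type} [AddCommGroup N]
    [Module R N] (h : ∀ i ≤ t, PK K P i N) : ∃ s, s ∉ P ∧ ∀ i ≤ t, ∀ k, Kill (K k) i s N := by
  induction t with
  | zero =>
    obtain ⟨s, hs, h1⟩ := h 0 le_rfl
    refine ⟨s, hs, fun i hi => ?_⟩
    obtain rfl : i = 0 := by omega
    exact h1
  | succ t ih =>
    obtain ⟨s, hs, h1⟩ := ih fun i hi => h i (by omega)
    obtain ⟨s', hs', h2⟩ := h (t+1) le_rfl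
    refine ⟨s * s', fun hh => (‹P.IsPrime›.mem_or_mem hh).elim hs hs', fun i hi k => ?_⟩
    rcases Nat.lt_or_ge t i with h3 | h3
    · obtain rfl : i = t + 1 := by omega
      exact (h2 k).mul s
    · exact (h1 i h3 k).mul' s'

lemma PK_all [IsNoetherianRing R] {K : ℕ → MC R} (hK : ∀ k, IsEmpty ((K k).ι 0)) {P : Ideal R}
    [hP : P.IsPrime] (x : R) (hx : ∀ r, r ∈ P ↔ r * x = 0)
    (hmin : ∀ p' : Ideal R, p'.IsPrime → p' ≤ P → p' = P) {t : ℕ} (hR : ∀ i ≤ t, PK K P i R)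
    (i : ℕ) (hi : i ≤ t) (C : Type) [AddCommGroup C] [Module R C] (hC : Module.Finite R C) :
    PK K P i C := by
  have one : (1 : R) ∉ P := fun h => hP.ne_top ((Ideal.eq_top_iff_one _).2 h)
  induction i generalizing C with
  | zero => exact ⟨1, one, fun _ => trivial⟩
  | succ i ih =>
    refine IsNoetherianRing.induction_on_isQuotientEquivQuotientPrime (A := R)
      (motive := fun N _ _ _ => PK K P (i+1) N) hC ?_ ?_ ?_
    · intro N _ _ _ _
      exact ⟨1, one, fun k => kill_of_smul _ _ _ fun x => Subsingleton.elim _ _⟩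
    · intro N _ _ _ p e
      by_cases hp : p.1 ≤ P
      · have hpP := hmin p.1 p.2 hp
        rw [hpP] at e
        obtain ⟨s, hs, h1⟩ := ih (by omega) (R ⧸ Ideal.span {x}) inferInstance
        obtain ⟨s', hs', h2⟩ := hR (i+1) hi
        refine ⟨s * s', fun hh => (hP.mem_or_mem hh).elim hs hs', fun k => ?_⟩
        have hker : LinearMap.ker (LinearMap.toSpanSingleton R R x) = P := by
          ext r; simp [hx]
        let f : (R ⧸ P) →ₗ[R] R := Submodule.liftQ P (LinearMap.toSpanSingleton R R x) hker.ge
        have hf : Function.Injective f := by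
          rw [← LinearMap.ker_eq_bot]
          exact Submodule.ker_liftQ_eq_bot _ _ _ hker.le
        refine Kill.equiv e.symm (kill_left f (Submodule.mkQ (Ideal.span {x})) hf
          (Submodule.mkQ_surjective _) ?_ (hK k) (h1 k) (h2 k))
        intro y
        rw [Submodule.mkQ_apply, Submodule.Quotient.mk_eq_zero, Ideal.mem_span_singleton']
        constructor
        · rintro ⟨a, ha⟩
          exact ⟨Submodule.Quotient.mk a, ha⟩
        · rintro ⟨a, ha⟩
          obtain ⟨a, rfl⟩ := Submodule.Quotient.mk_surjective _ a
          exact ⟨a, ha⟩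
      · obtain ⟨s, hs, hs'⟩ := Set.not_subset.1 hp
        refine ⟨s, hs', fun k => Kill.equiv e.symm (kill_of_smul _ _ _ ?_)⟩
        intro y
        obtain ⟨a, rfl⟩ := Submodule.Quotient.mk_surjective _ y
        rw [← Submodule.Quotient.mk_smul, Submodule.Quotient.mk_eq_zero]
        exact Ideal.mul_mem_right _ _ hs
    · intro N₁ _ _ _ N₂ _ _ _ N₃ _ _ _ f g hf hg hfg h1 h3
      obtain ⟨s, hs, h1⟩ := h1
      obtain ⟨s', hs', h3⟩ := h3
      exact ⟨s * s', fun hh => (hP.mem_or_mem hh).elim hs hs', fun k =>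
        kill_mid f g hf hg (fun y => hfg y) (h1 k) (h3 k)⟩

lemma Kill.proj {K : MC R} {n : ℕ} {s : R} (h : Kill K n s R) (Q : ModuleCat.{0} R)
    (hQ : FGProj R Q) : Kill K n s Q := by
  obtain ⟨h1, h2⟩ := hQ
  obtain ⟨m, f, hf⟩ := Module.Finite.exists_fin' R Q
  obtain ⟨g, hg⟩ := Module.projective_lifting_property f LinearMap.id hf
  refine Kill.retract g f (fun x => LinearMap.congr_fun hg x) ?_
  exact Kill.pi (F := fun _ : Fin m => R) fun _ => h

lemma kill_syz {K : MC R} (hK : IsEmpty (K.ι 0)) {t : ℕ} {s u : R}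
    (hs : ∀ i ≤ t, Kill K i s R) (M : ModuleCat.{0} R) (hu : ∀ i ≤ t, Kill K i u M)
    (j : ℕ) (N : ModuleCat.{0} R) (hN : IsNthSyzygy R j N M) (i : ℕ) (hi : i ≤ t) :
    Kill K i (u * s ^ i) N := by
  induction j generalizing N i with
  | zero =>
    obtain ⟨e⟩ := hN
    exact Kill.equiv e.symm ((hu i hi).mul' _)
  | succ j ih =>
    obtain ⟨N', hN', Q, f, hQ, hf, ⟨e⟩⟩ := hN
    cases i with
    | zero => trivial
    | succ i =>
      rw [pow_succ, ← mul_assoc]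
      refine Kill.equiv e.symm (kill_left (LinearMap.ker f).subtype f
        (Submodule.subtype_injective _) hf ?_ hK (ih N' hN' i (by omega)) ((hs (i+1) hi).proj Q hQ))
      intro x
      simp

lemma kill_bracket {K : MC R} (hK : IsEmpty (K.ι 0)) {t : ℕ} {s u : R}
    (hs : ∀ i ≤ t, Kill K i s R) (Y : ModuleCat.{0} R → Prop)
    (hu : ∀ M, Y M → ∀ i ≤ t, Kill K i u M)
    (N : ModuleCat.{0} R) (hN : Bracket R Y N) (i : ℕ) (hi : i ≤ t) :
    Kill K i (s * (u * s ^ t)) N := by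
  obtain ⟨k, f, N', hf, ⟨e⟩⟩ := hN
  have : Kill K i (s * (u * s ^ t)) ((j : Fin k) → f j) := by
    refine Kill.pi fun j => ?_
    rcases hf j with h | ⟨M, a, hM, ha⟩
    · exact ((hs i hi).proj _ h).mul' _
    · have := kill_syz hK hs M (hu M hM) a _ ha i hi
      obtain ⟨c, rfl⟩ := Nat.exists_eq_add_of_le hi
      rw [pow_add, ← mul_assoc u, mul_comm s]
      exact (this.mul' _).mul' _
  exact (this.equiv e.symm).retract (LinearMap.inl R N N') (LinearMap.fst R N N') (by simp)

lemma kill_ball {K : ℕ → MC R} (hK : ∀ k, IsEmpty ((K k).ι 0)) {P : Ideal R} [hP : P.IsPrime]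
    {t : ℕ} (C : ModuleCat.{0} R)
    (hR : ∀ i ≤ t, PK K P i R) (hC : ∀ i ≤ t, PK K P i C) (n : ℕ) :
    ∃ u, u ∉ P ∧ ∀ N, Ball R C (n+1) N → ∀ i ≤ t, ∀ k, Kill (K k) i u N := by
  obtain ⟨s, hs, hs'⟩ := PK.collect hR
  obtain ⟨c, hc, hc'⟩ := PK.collect hC
  have hmul : ∀ {a b : R}, a ∉ P → b ∉ P → a * b ∉ P :=
    fun ha hb hh => (hP.mem_or_mem hh).elim ha hb
  have hst : s ^ t ∉ P := fun h => hs (hP.mem_of_pow_mem _ h)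
  have h1 : ∀ N, Bracket R (fun M => Nonempty (M ≃ₗ[R] C)) N → ∀ i ≤ t, ∀ k,
      Kill (K k) i (s * (c * s ^ t)) N := fun N hN i hi k =>
    kill_bracket (hK k) (fun i hi => hs' i hi k) _
      (fun M ⟨e⟩ i hi => (hc' i hi k).equiv e.symm) N hN i hi
  induction n with
  | zero => exact ⟨_, hmul hs (hmul hc hst), h1⟩
  | succ n ih =>
    obtain ⟨u, hu, hu'⟩ := ih
    refine ⟨_, hmul hs (hmul (hmul hu (hmul hs (hmul hc hst))) hst), fun N hN i hi k => ?_⟩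
    refine kill_bracket (hK k) (fun i hi => hs' i hi k) _ ?_ N hN i hi
    rintro M ⟨A, B, f, g, hA, hB, h3, h4, h5⟩ i hi
    refine kill_mid f g h3 h4 ?_ (hu' A hA i hi k) (h1 B hB i hi k)
    intro x
    rw [← LinearMap.mem_ker, h5]; rfl

end PKsec
end Paper


namespace Paper
section Tens
variable {R : Type} [CommRing R] {X : ModuleCat.{0} R → Prop}

lemma Resolving.iso (hX : Resolving R X) {M N : ModuleCat.{0} R} (h : X M) (e : M ≃ₗ[R] N) :
    X N :=
  hX.summand M N (ModuleCat.of R PUnit) h ⟨e.trans LinearEquiv.prodUnique.symm⟩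

lemma Resolving.prod (hX : Resolving R X) {M N : ModuleCat.{0} R} (h : X M) (h' : X N) :
    X (ModuleCat.of R (M × N)) := by
  refine hX.extension M (ModuleCat.of R (M × N)) N (LinearMap.inl R M N) (LinearMap.snd R M N)
    ⟨LinearMap.inl_injective, LinearMap.snd_surjective, ?_⟩ h h'
  exact LinearMap.ker_snd R M N

lemma Resolving.pi (hX : Resolving R X) (M : ModuleCat.{0} R) (h : X M) (ι : Type) [Finite ι] :
    X (ModuleCat.of R (ι → M)) := by
  obtain ⟨n, ⟨e⟩⟩ := Finite.exists_equiv_fin ι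
  have : ∀ n : ℕ, X (ModuleCat.of R (Fin n → M)) := by
    intro n
    induction n with
    | zero =>
      refine hX.proj _ ⟨?_, ?_⟩
      · change Module.Finite R (Fin 0 → M); infer_instance
      · change Module.Projective R (Fin 0 → M); infer_instance
    | succ n ih =>
      exact hX.iso (hX.prod h ih) (Fin.consLinearEquiv R (fun _ : Fin (n+1) => M))
  exact hX.iso (this n) (LinearEquiv.funCongrLeft R M e)

/-- the cyclic-relation module attached to a vector -/
abbrev VQ {ι : Type} (v : ι → R) : ModuleCat.{0} R :=
  ModuleCat.of R ((ι → R) ⧸ Submodule.span R {v})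

lemma tens_step (hX : Resolving R X) {ι κ : Type} [Finite ι] [Finite κ] (v : ι → R) (w : κ → R)
    (hv : X (VQ v)) (hw : X (VQ w)) (hw0 : ∀ r : R, r • w = 0 → r = 0) :
    X (VQ (fun p : ι × κ => v p.1 * w p.2)) := by
  let f0 : (ι → R) →ₗ[R] (ι × κ → R) :=
    { toFun := fun a p => a p.1 * w p.2
      map_add' := fun a b => by ext p; simp [add_mul]
      map_smul' := fun r a => by ext p; simp [mul_assoc] }
  let f : VQ v →ₗ[R] VQ (fun p : ι × κ => v p.1 * w p.2) :=
    Submodule.mapQ _ _ f0 (by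
      rw [Submodule.span_le, Set.singleton_subset_iff]
      exact Submodule.mem_span_singleton_self _)
  let g0 : (ι × κ → R) →ₗ[R] (ι → ((κ → R) ⧸ Submodule.span R {w})) :=
    LinearMap.pi fun i => (Submodule.mkQ _).comp
      (LinearMap.funLeft R R (fun j : κ => (i, j)))
  have hg0 : Submodule.span R {(fun p : ι × κ => v p.1 * w p.2)} ≤ LinearMap.ker g0 := by
    rw [Submodule.span_le, Set.singleton_subset_iff]
    change g0 _ = 0
    ext i
    change Submodule.Quotient.mk _ = _
    refine (Submodule.Quotient.mk_eq_zero _).2 ?_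
    exact Submodule.mem_span_singleton.2 ⟨v i, rfl⟩
  let g : VQ (fun p : ι × κ => v p.1 * w p.2) →ₗ[R] ModuleCat.of R (ι → VQ w) :=
    Submodule.liftQ _ g0 hg0
  refine hX.extension (VQ v) _ (ModuleCat.of R (ι → VQ w)) f g ⟨?_, ?_, ?_⟩ hv
    (hX.pi (VQ w) hw ι)
  · rw [injective_iff_map_eq_zero]
    intro a
    obtain ⟨a, rfl⟩ := Submodule.Quotient.mk_surjective _ a
    intro ha
    obtain ⟨r, hr⟩ := Submodule.mem_span_singleton.1 ((Submodule.Quotient.mk_eq_zero _).1 ha)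
    refine (Submodule.Quotient.mk_eq_zero _).2 (Submodule.mem_span_singleton.2 ⟨r, ?_⟩)
    ext i
    have : r * v i - a i = 0 := by
      apply hw0
      ext j
      have := congrFun hr (i, j)
      change r * (v i * w j) = a i * w j at this
      simp [sub_mul, mul_assoc, this]
    simpa using sub_eq_zero.1 this
  · intro y
    choose b hb using fun i => Submodule.Quotient.mk_surjective _ (y i)
    refine ⟨Submodule.Quotient.mk fun p => b p.1 p.2, ?_⟩
    ext i
    exact hb i
  · ext y
    obtain ⟨y, rfl⟩ := Submodule.Quotient.mk_surjective _ y
    constructor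
    · intro hy
      have h1 : ∀ i, ∃ c : R, c • w = fun j => y (i, j) := fun i =>
        Submodule.mem_span_singleton.1 ((Submodule.Quotient.mk_eq_zero _).1 (congrFun hy i))
      choose c hc using h1
      refine ⟨Submodule.Quotient.mk c, ?_⟩
      change Submodule.Quotient.mk (f0 c) = _
      congr 1
      ext p
      exact congrFun (hc p.1) p.2
    · rintro ⟨c, hc⟩
      obtain ⟨c, rfl⟩ := Submodule.Quotient.mk_surjective _ c
      rw [← hc]
      change g0 (f0 c) = 0
      ext i
      refine (Submodule.Quotient.mk_eq_zero _).2 ?_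
      exact Submodule.mem_span_singleton.2 ⟨c i, rfl⟩

lemma tens_pow (hX : Resolving R X) {ι : Type} [Finite ι] (v : ι → R)
    (hv : X (VQ v)) (hv0 : ∀ r : R, r • v = 0 → r = 0) (l : ℕ) :
    ∃ (κ : Type) (_ : Finite κ) (w : κ → R), (∀ j, w j ∈ (Ideal.span (Set.range v)) ^ (l+1)) ∧
      (∀ r : R, r • w = 0 → r = 0) ∧ X (VQ w) := by
  induction l with
  | zero => exact ⟨ι, inferInstance, v, fun j => by
      simpa using Ideal.subset_span (Set.mem_range_self j), hv0, hv⟩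
  | succ l ih =>
    obtain ⟨κ, hκ, w, h1, h2, h3⟩ := ih
    refine ⟨ι × κ, inferInstance, fun p => v p.1 * w p.2, ?_, ?_, tens_step hX v w hv h3 h2⟩
    · intro p
      rw [pow_succ']
      exact Ideal.mul_mem_mul (Ideal.subset_span (Set.mem_range_self _)) (h1 _)
    · intro r hr
      apply hv0
      ext i
      apply h2
      ext j
      have := congrFun hr (i, j)
      simpa [mul_assoc] using this

end Tens

/-- main annihilator argument -/
theorem no_radius {R : Type} [CommRing R] [IsNoetherianRing R] [IsLocalRing R]
    {X : ModuleCat.{0} R → Prop} (hX : Resolving R X) {ι : Type} [Finite ι] (v : ι → R)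
    (hvm : ∀ i, v i ∈ IsLocalRing.maximalIdeal R)
    (hv : X (VQ v)) (hv0 : ∀ r : R, r • v = 0 → r = 0) : ¬ FiniteRadius R X := by
  rintro ⟨C, n, hXC, hball⟩
  have hCfin := hX.fg C hXC
  have := Fintype.ofFinite ι
  set l : List R := (Finset.univ : Finset ι).toList.map v with hl
  have hmem : ∀ i, v i ∈ l := fun i => by
    rw [hl, List.mem_map]; exact ⟨i, by simp, rfl⟩
  have hmem' : ∀ a ∈ l, a ∈ IsLocalRing.maximalIdeal R := by
    intro a ha
    rw [hl, List.mem_map] at ha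
    obtain ⟨i, _, rfl⟩ := ha
    exact hvm i
  set q := l.length with hq
  let K : ℕ → MC R := fun k => kosz (q+1) (l.map (· ^ k))
  have hK : ∀ k, IsEmpty ((K k).ι 0) := fun k => kosz_empty_low _ _ _ (by simp [hq])
  -- minimal prime
  obtain ⟨P, hP⟩ : (Module.annihilator R R).minimalPrimes.Nonempty := by
    rw [← Set.nonempty_coe_sort]
    refine Ideal.nonempty_minimalPrimes ?_
    intro h
    have : (1 : R) ∈ Module.annihilator R R := h ▸ Submodule.mem_top
    exact one_ne_zero (by simpa using Module.mem_annihilator.1 this 1 : (1:R) = 0)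
  have hPp : P.IsPrime := hP.1.1
  have hmin : ∀ p' : Ideal R, p'.IsPrime → p' ≤ P → p' = P := by
    intro p' h1 h2
    refine le_antisymm h2 (hP.2 ⟨h1, ?_⟩ h2)
    intro a ha
    have : a = 0 := by simpa using Module.mem_annihilator.1 ha 1
    rw [this]; exact zero_mem _
  obtain ⟨x, hx⟩ : ∃ x : R, ∀ r, r ∈ P ↔ r * x = 0 := by
    have := Module.associatedPrimes.minimalPrimes_annihilator_subset_associatedPrimes R R hP
    rw [AssociatedPrimes.mem_iff, isAssociatedPrime_iff] at this
    obtain ⟨_, x, hx⟩ := this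
    refine ⟨x, fun r => ?_⟩
    rw [hx, Submodule.mem_colon_singleton]; simp
  have hnot : ¬ PK K P (q+1) R := by
    rintro ⟨s, hs, h⟩
    apply hs
    have : s ∈ (⨅ k : ℕ, IsLocalRing.maximalIdeal R ^ k) := by
      rw [Ideal.mem_iInf]
      intro k
      have h1 := kosz_top_kill q _ s (h k)
      refine (Ideal.span_le.2 ?_ : Ideal.ofList (l.map (· ^ k)) ≤ _) h1
      intro a ha
      have ha : a ∈ l.map (· ^ k) := ha
      rw [List.mem_map] at ha
      obtain ⟨b, hb, rfl⟩ := ha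
      exact Ideal.pow_mem_pow (hmem' b hb) k
    rw [Ideal.iInf_pow_eq_bot_of_isLocalRing _ Ideal.IsPrime.ne_top'] at this
    rw [(Ideal.mem_bot).1 this]; exact zero_mem _
  classical
  have hex : ∃ i, ¬ PK K P i R := ⟨_, hnot⟩
  obtain ⟨t, ht⟩ : ∃ t, Nat.find hex = t + 1 := by
    refine Nat.exists_eq_succ_of_ne_zero ?_
    intro h0
    have := Nat.find_spec hex
    rw [h0] at this
    exact this ⟨1, fun h => hPp.ne_top ((Ideal.eq_top_iff_one _).2 h), fun _ => trivial⟩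
  have hRt : ∀ i ≤ t, PK K P i R := fun i hi => by
    by_contra h
    have := Nat.find_min' hex h
    omega
  have hRt' : ¬ PK K P (t+1) R := ht ▸ Nat.find_spec hex
  obtain ⟨u, hu, hu'⟩ := kill_ball hK C hRt
    (fun i hi => PK_all hK x hx hmin hRt i hi C hCfin) n
  refine hRt' ⟨u, hu, fun k => ?_⟩
  set I := Ideal.span (Set.range v) with hI
  have hrad : I ≤ (killIdeal (K k) (t+1) R).radical := by
    rw [hI, Ideal.span_le]
    rintro _ ⟨i, rfl⟩
    obtain ⟨c, hc⟩ := kosz_kill (M := R) (q+1) (l.map (· ^ k)) (v i ^ k)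
      (List.mem_map.2 ⟨_, hmem i, rfl⟩)
    refine ⟨k * c, ?_⟩
    rw [pow_mul]
    exact hc (t+1)
  obtain ⟨m, hm⟩ := Ideal.exists_pow_le_of_le_radical_of_fg hrad (IsNoetherian.noetherian I)
  obtain ⟨κ, hκ, w, hw1, hw2, hw3⟩ := tens_pow hX v hv hv0 m
  have hwk : ∀ j, Kill (K k) (t+1) (w j) R := fun j =>
    (hm.trans' (Ideal.pow_le_pow_right (Nat.le_succ m))) (hw1 j)
  refine kill_conn (LinearMap.toSpanSingleton R (κ → R) w) (Submodule.mkQ (Submodule.span R {w}))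
    ?_ (Submodule.mkQ_surjective _) ?_ (hK k) (hu' _ (hball _ hw3) t le_rfl k) ?_
  · rw [injective_iff_map_eq_zero]
    intro r hr
    exact hw2 r hr
  · intro y
    rw [Submodule.mkQ_apply, Submodule.Quotient.mk_eq_zero, Submodule.mem_span_singleton]
    rfl
  · intro z hz
    choose y hy using fun j => hwk j z hz
    refine ⟨fun b j => y j b, ?_⟩
    ext b j
    have := congrFun (hy j) b
    simpa [act, Finset.sum_apply, mul_comm] using this

end Paper


section SchanuelSec
variable {R : Type} [CommRing R] {L P N L' P' N' : Type} [AddCommGroup L] [Module R L]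
  [AddCommGroup P] [Module R P] [AddCommGroup N] [Module R N]
  [AddCommGroup L'] [Module R L'] [AddCommGroup P'] [Module R P'] [AddCommGroup N'] [Module R N']

lemma Paper.schanuel_half (f : L →ₗ[R] P) (g : P →ₗ[R] N) (g' : P' →ₗ[R] N)
    (hf : Function.Injective f) (hfg : Function.Exact f g)
    (hg : Function.Surjective g) [Module.Projective R P'] :
    Nonempty (LinearMap.ker (g.coprod (-g')) ≃ₗ[R] L × P') := by
  obtain ⟨β, hβ⟩ := Module.projective_lifting_property g g' hg
  have hβ' : ∀ x, g (β x) = g' x := LinearMap.congr_fun hβ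
  let i : L →ₗ[R] LinearMap.ker (g.coprod (-g')) :=
    LinearMap.codRestrict _ ((LinearMap.inl R P P').comp f) (by
      intro c; simp [hfg.apply_apply_eq_zero])
  let p : LinearMap.ker (g.coprod (-g')) →ₗ[R] P' :=
    (LinearMap.snd R P P').comp (Submodule.subtype _)
  have hex : Function.Exact i p := by
    rintro ⟨⟨a, b⟩, hab⟩
    have hab' : g a - g' b = 0 := by simpa [sub_eq_add_neg] using hab
    constructor
    · intro h
      have hb : b = 0 := h
      subst hb
      obtain ⟨c, hc⟩ := (hfg a).1 (by simpa using hab')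
      exact ⟨c, Subtype.ext (Prod.ext hc rfl)⟩
    · rintro ⟨c, hc⟩
      exact (congrArg (fun z => z.1.2) hc).symm
  have hi : Function.Injective i := by
    intro c d h
    exact hf (congrArg (fun z => z.1.1) h)
  let s : P' →ₗ[R] LinearMap.ker (g.coprod (-g')) :=
    LinearMap.codRestrict _ (β.prod LinearMap.id) (by intro c; simp [hβ'])
  exact ⟨(hex.splitSurjectiveEquiv hi ⟨s, by ext; rfl⟩).1⟩

lemma Paper.schanuel (f : L →ₗ[R] P) (g : P →ₗ[R] N) (f' : L' →ₗ[R] P') (g' : P' →ₗ[R] N)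
    (hf : Function.Injective f) (hfg : Function.Exact f g) (hg : Function.Surjective g)
    (hf' : Function.Injective f') (hfg' : Function.Exact f' g') (hg' : Function.Surjective g')
    [Module.Projective R P] [Module.Projective R P'] :
    Nonempty ((L × P') ≃ₗ[R] (L' × P)) := by
  obtain ⟨e1⟩ := Paper.schanuel_half f g g' hf hfg hg
  obtain ⟨e2⟩ := Paper.schanuel_half f' g' g hf' hfg' hg'
  let e3 : LinearMap.ker (g.coprod (-g')) ≃ₗ[R] LinearMap.ker (g'.coprod (-g)) :=
    (LinearEquiv.prodComm R P P').submoduleMap _ |>.trans (LinearEquiv.ofEq _ _ (by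
      ext ⟨a, b⟩
      simp only [Submodule.mem_map, LinearMap.mem_ker]
      constructor
      · rintro ⟨⟨c, d⟩, h, h'⟩
        obtain ⟨rfl, rfl⟩ : d = a ∧ c = b := by simpa using h'
        simp only [LinearMap.coprod_apply, LinearMap.neg_apply] at h ⊢
        rw [← neg_eq_zero, ← h]; abel
      · intro h
        refine ⟨(b, a), ?_, rfl⟩
        simp only [LinearMap.coprod_apply, LinearMap.neg_apply] at h ⊢
        rw [← neg_eq_zero, ← h]; abel))
  exact ⟨e1.symm.trans (e3.trans e2)⟩

lemma Paper.dual_half (f : L →ₗ[R] P) (g : P →ₗ[R] N) (f' : L →ₗ[R] P')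
    (hfg : Function.Exact f g) (hg : Function.Surjective g)
    (h : P →ₗ[R] P') (hh : h.comp f = f') :
    Nonempty (((P × P') ⧸ LinearMap.range (f.prod (-f'))) ≃ₗ[R] P' × N) := by
  have hh' : ∀ x, h (f x) = f' x := LinearMap.congr_fun hh
  let W := (P × P') ⧸ LinearMap.range (f.prod (-f'))
  let i : P' →ₗ[R] W := (Submodule.mkQ _).comp (LinearMap.inr R P P')
  let p : W →ₗ[R] N := Submodule.liftQ _ (g.comp (LinearMap.fst R P P')) (by
    rintro _ ⟨c, rfl⟩
    simp [hfg.apply_apply_eq_zero])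
  let r : W →ₗ[R] P' := Submodule.liftQ _ (h.coprod LinearMap.id) (by
    rintro _ ⟨c, rfl⟩
    simp [hh'])
  have hp : Function.Surjective p := by
    intro y
    obtain ⟨x, rfl⟩ := hg y
    exact ⟨Submodule.Quotient.mk (x, 0), rfl⟩
  have hex : Function.Exact i p := by
    intro w
    obtain ⟨⟨a, b⟩, rfl⟩ := Submodule.Quotient.mk_surjective _ w
    constructor
    · intro hw
      obtain ⟨c, rfl⟩ := (hfg a).1 hw
      refine ⟨b + f' c, ?_⟩
      refine (Submodule.Quotient.eq _).2 ⟨-c, ?_⟩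
      simp
    · rintro ⟨c, hc⟩
      rw [← hc]
      exact map_zero g
  refine ⟨(hex.splitInjectiveEquiv hp ⟨r, ?_⟩).1⟩
  ext x
  change h 0 + x = x
  simp

lemma Paper.dual_schanuel (f : L →ₗ[R] P) (g : P →ₗ[R] N) (f' : L →ₗ[R] P') (g' : P' →ₗ[R] N')
    (hfg : Function.Exact f g) (hg : Function.Surjective g)
    (hfg' : Function.Exact f' g') (hg' : Function.Surjective g')
    (h : P →ₗ[R] P') (hh : h.comp f = f') (h' : P' →ₗ[R] P) (hh' : h'.comp f' = f) :
    Nonempty ((N × P') ≃ₗ[R] (N' × P)) := by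
  obtain ⟨e1⟩ := Paper.dual_half f g f' hfg hg h hh
  obtain ⟨e2⟩ := Paper.dual_half f' g' f hfg' hg' h' hh'
  let e3 := Submodule.Quotient.equiv (LinearMap.range (f.prod (-f')))
    (LinearMap.range (f'.prod (-f))) (LinearEquiv.prodComm R P P') (by
      ext ⟨a, b⟩
      simp only [Submodule.mem_map, LinearMap.mem_range]
      constructor
      · rintro ⟨_, ⟨c, rfl⟩, h⟩
        refine ⟨-c, ?_⟩
        rw [← h]; simp
      · rintro ⟨c, h⟩
        refine ⟨_, ⟨-c, rfl⟩, ?_⟩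
        rw [← h]; simp)
  exact ⟨(LinearEquiv.prodComm R N P').trans (e1.symm.trans (e3.trans (e2.trans
    (LinearEquiv.prodComm R P N'))))⟩

end SchanuelSec

namespace Paper
section Stab
variable {R : Type} [CommRing R]

lemma FGProj.prod {P Q : ModuleCat.{0} R} (hP : FGProj R P) (hQ : FGProj R Q) :
    FGProj R (ModuleCat.of R (P × Q)) := by
  obtain ⟨h1, h2⟩ := hP
  obtain ⟨h3, h4⟩ := hQ
  exact ⟨inferInstanceAs (Module.Finite R (P × Q)), inferInstanceAs (Module.Projective R (P × Q))⟩

lemma FGProj.unit : FGProj R (ModuleCat.of R PUnit) :=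
  ⟨inferInstanceAs (Module.Finite R PUnit), inferInstanceAs (Module.Projective R PUnit)⟩

lemma SES.exact {L M N : ModuleCat.{0} R} {f : L →ₗ[R] M} {g : M →ₗ[R] N} (h : SES R f g) :
    Function.Exact f g := LinearMap.exact_iff.2 h.2.2

lemma SES.of_exact {L M N : ModuleCat.{0} R} {f : L →ₗ[R] M} {g : M →ₗ[R] N}
    (hf : Function.Injective f) (hg : Function.Surjective g) (h : Function.Exact f g) :
    SES R f g := ⟨hf, hg, LinearMap.exact_iff.1 h⟩

lemma StablyIso.of_equiv {M N : ModuleCat.{0} R} (e : M ≃ₗ[R] N) : StablyIso R M N :=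
  ⟨ModuleCat.of R PUnit, ModuleCat.of R PUnit, FGProj.unit, FGProj.unit,
    ⟨LinearEquiv.prodCongr e (LinearEquiv.refl R _)⟩⟩

lemma StablyIso.symm {M N : ModuleCat.{0} R} (h : StablyIso R M N) : StablyIso R N M := by
  obtain ⟨P, Q, hP, hQ, ⟨e⟩⟩ := h
  exact ⟨Q, P, hQ, hP, ⟨e.symm⟩⟩

lemma StablyIso.trans {M N L : ModuleCat.{0} R} (h : StablyIso R M N) (h' : StablyIso R N L) :
    StablyIso R M L := by
  obtain ⟨P, Q, hP, hQ, ⟨e⟩⟩ := h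
  obtain ⟨P', Q', hP', hQ', ⟨e'⟩⟩ := h'
  refine ⟨ModuleCat.of R (P × P'), ModuleCat.of R (Q' × Q), hP.prod hP', hQ'.prod hQ, ⟨?_⟩⟩
  exact (LinearEquiv.prodAssoc R M P P').symm.trans
    ((LinearEquiv.prodCongr e (LinearEquiv.refl R P')).trans
    ((LinearEquiv.prodAssoc R N Q P').trans
    ((LinearEquiv.prodCongr (LinearEquiv.refl R N) (LinearEquiv.prodComm R Q P')).trans
    ((LinearEquiv.prodAssoc R N P' Q).symm.trans
    ((LinearEquiv.prodCongr e' (LinearEquiv.refl R Q)).trans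
    (LinearEquiv.prodAssoc R L Q' Q))))))

lemma IsSyzygy.ses {N K : ModuleCat.{0} R} (h : IsSyzygy R N K) :
    ∃ (P : ModuleCat.{0} R) (f : N →ₗ[R] P) (g : P →ₗ[R] K), FGProj R P ∧ SES R f g := by
  obtain ⟨P, g, hP, hg, ⟨e⟩⟩ := h
  refine ⟨P, (LinearMap.ker g).subtype.comp e.toLinearMap, g, hP, ?_, hg, ?_⟩
  · exact (Submodule.subtype_injective _).comp e.injective
  · rw [LinearMap.range_comp]; simp

lemma SES.isSyzygy {N P K : ModuleCat.{0} R} {f : N →ₗ[R] P} {g : P →ₗ[R] K} (h : SES R f g)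
    (hP : FGProj R P) : IsSyzygy R N K := by
  obtain ⟨hf, hg, hfg⟩ := h
  exact ⟨P, g, hP, hg, ⟨(LinearEquiv.ofInjective f hf).trans (LinearEquiv.ofEq _ _ hfg.symm)⟩⟩

lemma StablyIso.syz {L P N L' P' N' : ModuleCat.{0} R} {f : L →ₗ[R] P} {g : P →ₗ[R] N}
    {f' : L' →ₗ[R] P'} {g' : P' →ₗ[R] N'} (h : SES R f g) (h' : SES R f' g') (hP : FGProj R P)
    (hP' : FGProj R P') (hN : StablyIso R N N') : StablyIso R L L' := by
  obtain ⟨U, V, hU, hV, ⟨e⟩⟩ := hN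
  have hPU := hP.prod hU
  have hPV := hP'.prod hV
  have i1 : Module.Projective R (P × U) := hPU.2
  have i2 : Module.Projective R (P' × V) := hPV.2
  refine ⟨_, _, hPV, hPU, Paper.schanuel ((LinearMap.inl R P U).comp f)
    (e.toLinearMap.comp (g.prodMap LinearMap.id)) ((LinearMap.inl R P' V).comp f')
    (g'.prodMap LinearMap.id) ?_ ?_ ?_ ?_ ?_ ?_⟩
  · exact LinearMap.inl_injective.comp h.1
  · rintro ⟨a, b⟩
    constructor
    · intro hab
      have : (g.prodMap LinearMap.id) (a, b) = 0 := by
        apply e.injective; rw [map_zero]; exact hab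
      have h1 : g a = 0 := congrArg Prod.fst this
      have h2 : b = 0 := congrArg Prod.snd this
      obtain ⟨c, rfl⟩ := (h.exact a).1 h1
      exact ⟨c, by rw [h2]; rfl⟩
    · rintro ⟨c, hc⟩
      rw [← hc]
      simp [h.exact.apply_apply_eq_zero]
  · exact e.surjective.comp (Function.Surjective.prodMap h.2.1 Function.surjective_id)
  · exact LinearMap.inl_injective.comp h'.1
  · rintro ⟨a, b⟩
    constructor
    · intro this
      have h1 : g' a = 0 := congrArg Prod.fst this
      have h2 : b = 0 := congrArg Prod.snd this
      obtain ⟨c, rfl⟩ := (h'.exact a).1 h1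
      exact ⟨c, by rw [h2]; rfl⟩
    · rintro ⟨c, hc⟩
      rw [← hc]
      simp [h'.exact.apply_apply_eq_zero]
  · exact Function.Surjective.prodMap h'.2.1 Function.surjective_id

lemma nthSyz_stablyIso {M : ModuleCat.{0} R} (j : ℕ) (N N' : ModuleCat.{0} R)
    (h : IsNthSyzygy R j N M) (h' : IsNthSyzygy R j N' M) : StablyIso R N N' := by
  induction j generalizing N N' with
  | zero =>
    obtain ⟨e⟩ := h
    obtain ⟨e'⟩ := h'
    exact StablyIso.of_equiv (e.trans e'.symm)
  | succ j ih =>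
    obtain ⟨K, hK, hN⟩ := h
    obtain ⟨K', hK', hN'⟩ := h'
    obtain ⟨P, f, g, hP, hs⟩ := hN.ses
    obtain ⟨P', f', g', hP', hs'⟩ := hN'.ses
    exact StablyIso.syz hs hs' hP hP' (ih K K' hK hK')

lemma extend_proj {L P : ModuleCat.{0} R} {f : L →ₗ[R] P}
    (h : ∀ a : L →ₗ[R] R, ∃ b : P →ₗ[R] R, b.comp f = a) (Q : ModuleCat.{0} R) (hQ : FGProj R Q)
    (a : L →ₗ[R] Q) : ∃ b : P →ₗ[R] Q, b.comp f = a := by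
  obtain ⟨h1, h2⟩ := hQ
  obtain ⟨m, p, hp⟩ := Module.Finite.exists_fin' R Q
  obtain ⟨s, hs⟩ := Module.projective_lifting_property p LinearMap.id hp
  choose b hb using fun j : Fin m => h ((LinearMap.proj j).comp (s.comp a))
  refine ⟨p.comp (LinearMap.pi b), ?_⟩
  have : (LinearMap.pi b).comp f = s.comp a := by
    ext x j
    exact LinearMap.congr_fun (hb j) x
  rw [LinearMap.comp_assoc, this, ← LinearMap.comp_assoc, hs, LinearMap.id_comp]

lemma StablyIso.cosyz {L P N L' P' N' : ModuleCat.{0} R} {f : L →ₗ[R] P} {g : P →ₗ[R] N}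
    {f' : L' →ₗ[R] P'} {g' : P' →ₗ[R] N'} (h : SES R f g) (h' : SES R f' g') (hP : FGProj R P)
    (hP' : FGProj R P') (hE : ∀ a : L →ₗ[R] R, ∃ b : P →ₗ[R] R, b.comp f = a)
    (hE' : ∀ a : L' →ₗ[R] R, ∃ b : P' →ₗ[R] R, b.comp f' = a)
    (hL : StablyIso R L L') : StablyIso R N N' := by
  obtain ⟨U, V, hU, hV, ⟨e⟩⟩ := hL
  have hPU := hP.prod hU
  have hPV := hP'.prod hV
  have key : ∀ {L P U : ModuleCat.{0} R} {f : L →ₗ[R] P},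
      (∀ a : L →ₗ[R] R, ∃ b : P →ₗ[R] R, b.comp f = a) → ∀ (Q : ModuleCat.{0} R), FGProj R Q →
      ∀ a : (L × U) →ₗ[R] Q, ∃ b : (P × U) →ₗ[R] Q, b.comp (f.prodMap LinearMap.id) = a := by
    intro L P U f hE Q hQ a
    obtain ⟨b, hb⟩ := extend_proj hE Q hQ (a.comp (LinearMap.inl R L U))
    refine ⟨b.coprod (a.comp (LinearMap.inr R L U)), ?_⟩
    refine LinearMap.ext fun x => ?_
    have := LinearMap.congr_fun hb x.1
    simp only [LinearMap.comp_apply, LinearMap.inl_apply] at this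
    simp only [LinearMap.comp_apply, LinearMap.prodMap_apply, LinearMap.coprod_apply, this,
      LinearMap.inr_apply, LinearMap.id_apply]
    rw [← map_add]; simp
  have hex : ∀ {L P N U : ModuleCat.{0} R} {f : L →ₗ[R] P} {g : P →ₗ[R] N}, SES R f g →
      Function.Exact (f.prodMap (LinearMap.id : U →ₗ[R] U)) (g.comp (LinearMap.fst R P U)) := by
    rintro L P N U f g h ⟨a, b⟩
    constructor
    · intro hab
      obtain ⟨c, rfl⟩ := (h.exact a).1 hab
      exact ⟨(c, b), rfl⟩
    · rintro ⟨c, hc⟩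
      rw [← hc]
      simp [h.exact.apply_apply_eq_zero]
  obtain ⟨b, hb⟩ := key (U := U) hE _ hPV ((f'.prodMap LinearMap.id).comp e.toLinearMap)
  obtain ⟨b', hb'⟩ := key (U := V) hE' _ hPU ((f.prodMap LinearMap.id).comp e.symm.toLinearMap)
  refine ⟨_, _, hPV, hPU, Paper.dual_schanuel (f.prodMap LinearMap.id)
    (g.comp (LinearMap.fst R P U)) ((f'.prodMap LinearMap.id).comp e.toLinearMap)
    (g'.comp (LinearMap.fst R P' V)) (hex h) ?_ ?_ ?_ b hb b' ?_⟩
  · exact h.2.1.comp LinearMap.fst_surjective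
  · intro y
    rw [hex h' y]
    constructor
    · rintro ⟨c, hc⟩
      exact ⟨e.symm c, by simpa using hc⟩
    · rintro ⟨c, hc⟩
      exact ⟨e c, hc⟩
  · exact h'.2.1.comp LinearMap.fst_surjective
  · rw [← LinearMap.comp_assoc, hb', LinearMap.comp_assoc]
    ext x <;> simp

end Stab
end Paper


namespace Paper
section Chain
variable {R : Type} [CommRing R]

lemma syz_exists [IsNoetherianRing R] (Y : ModuleCat.{0} R) (hY : Module.Finite R Y) :
    ∃ (Y' F : ModuleCat.{0} R) (f : Y' →ₗ[R] F) (g : F →ₗ[R] Y), FGProj R F ∧ SES R f g := by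
  obtain ⟨m, p, hp⟩ := Module.Finite.exists_fin' R Y
  refine ⟨ModuleCat.of R (LinearMap.ker p), ModuleCat.of R (Fin m → R),
    (LinearMap.ker p).subtype, p, ⟨?_, ?_⟩, Submodule.subtype_injective _, hp, ?_⟩
  · exact inferInstanceAs (Module.Finite R (Fin m → R))
  · exact inferInstanceAs (Module.Projective R (Fin m → R))
  · exact (Submodule.range_subtype _).symm

lemma Resolving.nthSyz {X : ModuleCat.{0} R → Prop} (hX : Resolving R X) {M : ModuleCat.{0} R}
    (hM : X M) (j : ℕ) (N : ModuleCat.{0} R) (h : IsNthSyzygy R j N M) : X N := by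
  induction j generalizing N with
  | zero =>
    obtain ⟨e⟩ := h
    exact hX.iso hM e.symm
  | succ j ih =>
    obtain ⟨K, hK, hN⟩ := h
    obtain ⟨P, f, g, hP, hs⟩ := hN.ses
    exact hX.ker_epi _ _ _ f g hs (hX.proj P hP) (ih K hK)

lemma chain_periodic [IsNoetherianRing R] {X : ModuleCat.{0} R → Prop} (hX : Resolving R X)
    {M G : ModuleCat.{0} R} (hM : X M) (g : ℕ) (hG : IsNthSyzygy R g G M)
    (hTR : TotallyReflexive R G) (n t : ℕ) (hn : g ≤ n) (ht : 0 < t)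
    (hper : ∃ A B : ModuleCat.{0} R, IsNthSyzygy R n A M ∧ IsNthSyzygy R (n + t) B M ∧
      Nonempty (A ≃ₗ[R] B)) :
    ∃ (U V Y F L F' L' : ModuleCat.{0} R) (j : Y →ₗ[R] F) (p : F →ₗ[R] L) (j' : L →ₗ[R] F')
      (p' : F' →ₗ[R] L'), FGProj R U ∧ FGProj R V ∧ FGProj R F ∧ FGProj R F' ∧ X L' ∧
      SES R j p ∧ SES R j' p' ∧ (∀ a : Y →ₗ[R] R, ∃ b : F →ₗ[R] R, b.comp j = a) ∧
      Nonempty ((G × U) ≃ₗ[R] (Y × V)) := by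
  have h0 : ∀ Y : ModuleCat.{0} R, ∃ Y' : ModuleCat.{0} R, Module.Finite R Y →
      ∃ (F : ModuleCat.{0} R) (f : Y' →ₗ[R] F) (g : F →ₗ[R] Y), FGProj R F ∧ SES R f g := by
    intro Y
    by_cases hY : Module.Finite R Y
    · obtain ⟨Y', h⟩ := syz_exists Y hY
      exact ⟨Y', fun _ => h⟩
    · exact ⟨Y, fun h => absurd h hY⟩
  choose S hS using h0
  obtain ⟨Y, hY0, hYs⟩ : ∃ Y : ℕ → ModuleCat.{0} R, Y 0 = G ∧ ∀ i, Y (i+1) = S (Y i) :=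
    ⟨fun i => Nat.rec G (fun _ => S) i, rfl, fun _ => rfl⟩
  subst hY0
  have hXY : ∀ i, X (Y i) := by
    intro i
    induction i with
    | zero => exact hX.nthSyz hM g _ hG
    | succ i ih =>
      obtain ⟨F, f, q, hF, hs⟩ := hS (Y i) (hX.fg _ ih)
      rw [hYs]
      exact hX.ker_epi _ _ _ f q hs (hX.proj F hF) ih
  have hses : ∀ i, ∃ (F : ModuleCat.{0} R) (f : Y (i+1) →ₗ[R] F) (q : F →ₗ[R] Y i),
      FGProj R F ∧ SES R f q := by
    intro i
    rw [hYs]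
    exact hS (Y i) (hX.fg _ (hXY i))
  choose F f q hF hs using hses
  have hext : ∀ i k, ExtVanish R (Y i) (ModuleCat.of R R) (k+1) := by
    intro i
    induction i with
    | zero => exact fun k => (hTR.2 (k+1) (Nat.succ_pos k)).1
    | succ i ih => exact fun k => (extVanish_shift (hs i) (hF i).2 _ k).1 (ih (k+1))
  have hE : ∀ i, ∀ a : Y (i+1) →ₗ[R] R, ∃ b : F i →ₗ[R] R, b.comp (f i) = a := fun i =>
    (extVanish_one (hs i) (hF i).2 (ModuleCat.of R R)).1 (hext i 0)
  have hnth : ∀ i, IsNthSyzygy R (g + i) (Y i) M := by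
    intro i
    induction i with
    | zero => exact hG
    | succ i ih => exact ⟨Y i, ih, (hs i).isSyzygy (hF i)⟩
  have hup : ∀ a b c, StablyIso R (Y a) (Y b) → StablyIso R (Y (a+c)) (Y (b+c)) := by
    intro a b c h
    induction c with
    | zero => exact h
    | succ c ih => exact StablyIso.syz (hs (a+c)) (hs (b+c)) (hF _) (hF _) ih
  have hdown : ∀ c b, StablyIso R (Y c) (Y (b+c)) → StablyIso R (Y 0) (Y b) := by
    intro c b h
    induction c with
    | zero => exact h
    | succ c ih =>
      exact ih (StablyIso.cosyz (hs c) (hs (b+c)) (hF _) (hF _) (hE _) (hE _) h)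
  obtain ⟨A, B, hA, hB, ⟨e⟩⟩ := hper
  obtain ⟨s, rfl⟩ := Nat.exists_eq_add_of_le hn
  have h1 : StablyIso R (Y s) (Y (s+t)) := by
    refine (nthSyz_stablyIso _ _ _ (hnth s) hA).trans ((StablyIso.of_equiv e).trans ?_)
    exact nthSyz_stablyIso _ _ _ hB (by rw [add_assoc]; exact hnth (s+t))
  have h2 := h1.trans (hup _ _ t h1)
  obtain ⟨r, hr⟩ : ∃ r, t + t = r + 2 := ⟨t + t - 2, by omega⟩
  have h3 : s + t + t = (r + 2) + s := by omega
  rw [h3] at h2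
  obtain ⟨U, V, hU, hV, e'⟩ := hdown s (r+2) h2
  exact ⟨U, V, Y (r+2), F (r+1), Y (r+1), F r, Y r, f (r+1), q (r+1), f r, q r, hU, hV, hF _, hF _,
    hXY r, hs _, hs _, hE _, e'⟩

/-- the non-split map between free modules with cokernel in `X` -/
lemma exists_phi {X : ModuleCat.{0} R → Prop} (hX : Resolving R X)
    {G P K U V Y F L F' L' : ModuleCat.{0} R} {i0 : G →ₗ[R] P} {π : P →ₗ[R] K}
    {j0 : Y →ₗ[R] F} {p0 : F →ₗ[R] L} {j' : L →ₗ[R] F'} {p' : F' →ₗ[R] L'}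
    (hP : FGProj R P) (hU : FGProj R U) (hV : FGProj R V) (hF : FGProj R F) (hF' : FGProj R F')
    (hK : X K) (hL' : X L') (hs0 : SES R i0 π) (hs : SES R j0 p0) (hs' : SES R j' p')
    (hE : ∀ a : Y →ₗ[R] R, ∃ b : F →ₗ[R] R, b.comp j0 = a)
    (e : (G × U) ≃ₗ[R] (Y × V))
    (hne : ¬ ∀ a : G →ₗ[R] R, ∃ b : P →ₗ[R] R, b.comp i0 = a) :
    ∃ (A Q : ModuleCat.{0} R) (φ : A →ₗ[R] Q), FGProj R A ∧ FGProj R Q ∧ Function.Injective φ ∧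
      (¬ ∃ ρ : Q →ₗ[R] A, ρ.comp φ = LinearMap.id) ∧
      X (ModuleCat.of R (Q ⧸ LinearMap.range φ)) := by
  push Not at hne
  obtain ⟨a, ha⟩ := hne
  let A := ModuleCat.of R (F × V)
  let P1 := ModuleCat.of R (P × U)
  let Q := ModuleCat.of R ((P × U) × F')
  have hA : FGProj R A := hF.prod hV
  have hP1 : FGProj R P1 := hP.prod hU
  have hQ : FGProj R Q := hP1.prod hF'
  let i : (G × U) →ₗ[R] (P × U) := i0.prodMap LinearMap.id
  let j : (G × U) →ₗ[R] (F × V) := (j0.prodMap LinearMap.id).comp e.toLinearMap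
  have hj : Function.Injective j :=
    (Function.Injective.prodMap hs.1 Function.injective_id).comp e.injective
  have hi : Function.Injective i := Function.Injective.prodMap hs0.1 Function.injective_id
  -- extension along `j`
  have hEj : ∀ (W : ModuleCat.{0} R), FGProj R W → ∀ c : (G × U) →ₗ[R] W,
      ∃ b : (F × V) →ₗ[R] W, b.comp j = c := by
    intro W hW c
    obtain ⟨b, hb⟩ := extend_proj hE W hW
      ((c.comp e.symm.toLinearMap).comp (LinearMap.inl R Y V))
    refine ⟨b.coprod ((c.comp e.symm.toLinearMap).comp (LinearMap.inr R Y V)), ?_⟩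
    refine LinearMap.ext fun x => ?_
    obtain ⟨y, rfl⟩ := e.symm.surjective x
    have := LinearMap.congr_fun hb y.1
    simp only [LinearMap.comp_apply, LinearMap.inl_apply] at this
    simp only [j, LinearMap.comp_apply, LinearMap.prodMap_apply, LinearMap.coprod_apply,
      LinearEquiv.coe_coe, LinearEquiv.apply_symm_apply, this,
      LinearMap.inr_apply, LinearMap.id_apply]
    rw [← map_add, ← map_add]; simp
  obtain ⟨h, hh⟩ := hEj P1 hP1 i
  have hh' : ∀ x, h (j x) = i x := LinearMap.congr_fun hh
  let pA : (F × V) →ₗ[R] L := p0.comp (LinearMap.fst R F V)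
  have hpA : ∀ x, pA x = 0 ↔ ∃ y, j y = x := by
    rintro ⟨x, v⟩
    constructor
    · intro hx
      obtain ⟨c, rfl⟩ := (hs.exact x).1 hx
      exact ⟨e.symm (c, v), by simp [j]⟩
    · rintro ⟨y, hy⟩
      rw [← hy]
      simp [pA, j, hs.exact.apply_apply_eq_zero]
  let φ : (F × V) →ₗ[R] ((P × U) × F') := h.prod (j'.comp pA)
  refine ⟨A, Q, φ, hA, hQ, ?_, ?_, ?_⟩
  · rw [injective_iff_map_eq_zero]
    intro x hx
    have hx1 : h x = 0 := congrArg Prod.fst hx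
    have hx2 : j' (pA x) = 0 := congrArg Prod.snd hx
    have hx3 : pA x = 0 := hs'.1 (by rw [hx2, map_zero])
    obtain ⟨y, rfl⟩ := (hpA x).1 hx3
    have : y = 0 := hi (by rw [map_zero, ← hh', hx1])
    rw [this, map_zero]
  · rintro ⟨ρ, hρ⟩
    obtain ⟨b, hb⟩ := hEj (ModuleCat.of R R)
      ⟨inferInstanceAs (Module.Finite R R), inferInstanceAs (Module.Projective R R)⟩
      (a.comp (LinearMap.fst R G U))
    let ρ' : ((P × U) × F') →ₗ[R] (F × V) := ρ
    let bb : P →ₗ[R] R := (b.comp ρ').comp ((LinearMap.inl R (P × U) F').comp (LinearMap.inl R P U))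
    apply ha bb
    refine LinearMap.ext fun x => ?_
    have h1 : φ (j (x, 0)) = ((i0 x, 0), 0) := by
      have h2 : pA (j (x, 0)) = 0 := (hpA _).2 ⟨_, rfl⟩
      change (h (j (x, 0)), j' (pA (j (x, 0)))) = _
      rw [hh', h2, map_zero]
      rfl
    have h3 : ρ' (φ (j (x, 0))) = j (x, 0) := LinearMap.congr_fun hρ (j (x, 0))
    rw [h1] at h3
    change b (ρ' ((i0 x, 0), 0)) = a x
    rw [h3]
    exact LinearMap.congr_fun hb (x, 0)
  · -- extension `0 → K → Q / φ A → L' → 0`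
    let N := ((P × U) × F') ⧸ LinearMap.range φ
    let k0 : P →ₗ[R] N := (Submodule.mkQ (LinearMap.range φ)).comp
      ((LinearMap.inl R (P × U) F').comp (LinearMap.inl R P U))
    have hk0 : LinearMap.ker π = LinearMap.ker k0 := by
      rw [hs0.2.2]
      ext x
      constructor
      · rintro ⟨y, rfl⟩
        refine (Submodule.Quotient.mk_eq_zero _).2 ⟨j (y, 0), ?_⟩
        have h2 : pA (j (y, 0)) = 0 := (hpA _).2 ⟨_, rfl⟩
        change (h (j (y, 0)), j' (pA (j (y, 0)))) = _
        rw [hh', h2, map_zero]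
        rfl
      · intro hx
        obtain ⟨z, hz⟩ := (Submodule.Quotient.mk_eq_zero _).1 hx
        have hz1 : h z = (x, 0) := congrArg Prod.fst hz
        have hz2 : j' (pA z) = 0 := congrArg Prod.snd hz
        have hz3 : pA z = 0 := hs'.1 (by rw [hz2, map_zero])
        obtain ⟨y, rfl⟩ := (hpA z).1 hz3
        rw [hh'] at hz1
        exact ⟨y.1, congrArg Prod.fst hz1⟩
    obtain ⟨k, hk⟩ := LinearMap.exists_extend_of_surj π hs0.2.1 k0 hk0.le
    have hk' : ∀ x, k (π x) = k0 x := LinearMap.congr_fun hk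
    let q : N →ₗ[R] L' := Submodule.liftQ _ (p'.comp (LinearMap.snd R (P × U) F')) (by
      rintro _ ⟨c, rfl⟩
      change p' (j' (pA c)) = 0
      exact hs'.exact.apply_apply_eq_zero _)
    refine hX.extension K (ModuleCat.of R N) L' k q (SES.of_exact ?_ ?_ ?_) hK hL'
    · rw [injective_iff_map_eq_zero]
      intro x hx
      obtain ⟨x, rfl⟩ := hs0.2.1 x
      have : x ∈ LinearMap.ker k0 := by rw [LinearMap.mem_ker, ← hk', hx]
      rw [← hk0] at this
      exact this
    · intro y
      obtain ⟨x, rfl⟩ := hs'.2.1 y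
      exact ⟨Submodule.Quotient.mk (0, x), rfl⟩
    · intro y
      obtain ⟨⟨⟨x, u⟩, w⟩, rfl⟩ := Submodule.Quotient.mk_surjective _ y
      constructor
      · intro hy
        have hy' : p' w = 0 := hy
        obtain ⟨l, rfl⟩ := (hs'.exact w).1 hy'
        obtain ⟨x1, rfl⟩ := hs.2.1 l
        -- subtract `φ` of a lift, then remove the `U` coordinate
        let d : F × V := (x1, 0)
        let u' : U := u - (h d).2
        refine ⟨π (x - (h d).1), ?_⟩
        rw [hk']
        refine (Submodule.Quotient.eq _).2 ⟨-d - j (0, u'), ?_⟩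
        have h2 : pA (j (0, u')) = 0 := (hpA _).2 ⟨_, rfl⟩
        change (h (-d - j (0, u')), j' (pA (-d - j (0, u')))) = _
        rw [map_sub, map_sub, h2, hh', map_neg, map_neg, sub_zero, map_neg]
        have hpd : pA d = p0 x1 := rfl
        have hi0 : i (0, u') = (0, u') := by simp [i]
        rw [hpd, hi0]
        refine Prod.ext (Prod.ext ?_ ?_) ?_
        · change -(h d).1 - (0 : P) = x - (h d).1 - x
          abel
        · change -(h d).2 - (u - (h d).2) = 0 - u
          abel
        · simp
      · rintro ⟨c, hc⟩
        obtain ⟨c, rfl⟩ := hs0.2.1 c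
        rw [hk'] at hc
        rw [← hc]
        exact map_zero p'

end Chain
end Paper


namespace Paper
section Vec
open TensorProduct
variable {R : Type} [CommRing R] [IsNoetherianRing R] [IsLocalRing R]

lemma exists_min_elt {A Q : Type} [AddCommGroup A] [Module R A] [AddCommGroup Q] [Module R Q]
    [Module.Finite R A] [Module.Finite R Q] [Module.Free R Q] {m : Type} [Fintype m]
    (bA : Module.Basis m R A) (φ : A →ₗ[R] Q)
    (h : ¬ ∃ ρ : Q →ₗ[R] A, ρ.comp φ = LinearMap.id) :
    ∃ e : A, (∃ i, IsUnit (bA.repr e i)) ∧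
      ∀ c : Q →ₗ[R] R, c (φ e) ∈ IsLocalRing.maximalIdeal R := by
  rw [IsLocalRing.split_injective_iff_lTensor_residueField_injective,
    injective_iff_map_eq_zero] at h
  push Not at h
  obtain ⟨x, hx, hx0⟩ := h
  obtain ⟨e, rfl⟩ : ∃ e : A, (1 : IsLocalRing.ResidueField R) ⊗ₜ[R] e = x := by
    clear hx hx0
    induction x using TensorProduct.induction_on with
    | zero => exact ⟨0, by simp⟩
    | tmul a b =>
      obtain ⟨a, rfl⟩ := IsLocalRing.residue_surjective a
      refine ⟨a • b, ?_⟩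
      rw [← TensorProduct.smul_tmul]
      congr 1
      rw [Algebra.smul_def, mul_one]; rfl
    | add x y h1 h2 =>
      obtain ⟨a, rfl⟩ := h1
      obtain ⟨b, rfl⟩ := h2
      exact ⟨a + b, TensorProduct.tmul_add _ _ _⟩
  refine ⟨e, ?_, ?_⟩
  · by_contra hcon
    push Not at hcon
    apply hx0
    rw [← bA.sum_repr e, TensorProduct.tmul_sum]
    refine Finset.sum_eq_zero fun i _ => ?_
    rw [← TensorProduct.smul_tmul, Algebra.smul_def, mul_one]
    have : algebraMap R (IsLocalRing.ResidueField R) (bA.repr e i) = 0 :=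
      (IsLocalRing.residue_eq_zero_iff _).2 ((IsLocalRing.mem_maximalIdeal _).2 (hcon i))
    rw [this, TensorProduct.zero_tmul]
  · intro c
    have h1 := congrArg (TensorProduct.rid R (IsLocalRing.ResidueField R))
      (congrArg (c.lTensor (IsLocalRing.ResidueField R)) hx)
    simp only [LinearMap.lTensor_tmul, map_zero, TensorProduct.rid_tmul] at h1
    rw [Algebra.smul_def, mul_one] at h1
    exact (IsLocalRing.residue_eq_zero_iff _).1 h1

lemma exists_vec {X : ModuleCat.{0} R → Prop} (hX : Resolving R X)
    {A Q : ModuleCat.{0} R} (φ : A →ₗ[R] Q) (hA : FGProj R A) (hQ : FGProj R Q)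
    (hφ : Function.Injective φ) (hns : ¬ ∃ ρ : Q →ₗ[R] A, ρ.comp φ = LinearMap.id)
    (hXq : X (ModuleCat.of R (Q ⧸ LinearMap.range φ))) :
    ∃ (ι : Type) (_ : Finite ι) (v : ι → R), (∀ i, v i ∈ IsLocalRing.maximalIdeal R) ∧
      X (VQ v) ∧ ∀ r : R, r • v = 0 → r = 0 := by
  obtain ⟨i1, i2⟩ := hA
  obtain ⟨i3, i4⟩ := hQ
  have i5 : Module.Free R A := Module.free_of_flat_of_isLocalRing
  have i6 : Module.Free R Q := Module.free_of_flat_of_isLocalRing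
  let bA := Module.Free.chooseBasis R A
  let bQ := Module.Free.chooseBasis R Q
  obtain ⟨e, ⟨i, hi⟩, hc⟩ := exists_min_elt bA φ hns
  obtain ⟨d, hd⟩ := hi.exists_left_inv
  let ρ : A →ₗ[R] R := d • bA.coord i
  have hρ : ρ e = 1 := hd
  have hann : ∀ r : R, r • φ e = 0 → r = 0 := by
    intro r hr
    rw [← map_smul] at hr
    have h1 : r • e = 0 := hφ (by rw [hr, map_zero])
    have h2 := congrArg ρ h1
    simpa [hρ] using h2
  let v : Module.Free.ChooseBasisIndex R Q → R := bQ.equivFun (φ e)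
  refine ⟨Module.Free.ChooseBasisIndex R Q, inferInstance, v, fun k => hc (bQ.coord k), ?_, ?_⟩
  · let F1 := ModuleCat.of R (LinearMap.ker ρ)
    have hF1 : FGProj R F1 := by
      refine ⟨inferInstanceAs (Module.Finite R (LinearMap.ker ρ)), ?_⟩
      let pr : A →ₗ[R] LinearMap.ker ρ := LinearMap.codRestrict _
        (LinearMap.id - ρ.smulRight e) (by intro a; simp [hρ])
      exact Module.Projective.of_split (LinearMap.ker ρ).subtype pr (by
        refine LinearMap.ext fun a => Subtype.ext ?_
        have : ρ a.1 = 0 := a.2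
        change a.1 - ρ a.1 • e = a.1
        rw [this, zero_smul, sub_zero])
    let W := Q ⧸ Submodule.span R {φ e}
    let f : LinearMap.ker ρ →ₗ[R] W := (Submodule.mkQ _).comp (φ.comp (LinearMap.ker ρ).subtype)
    let g : W →ₗ[R] (Q ⧸ LinearMap.range φ) := Submodule.factor (by
      rw [Submodule.span_le, Set.singleton_subset_iff]
      exact ⟨e, rfl⟩)
    have hW : X (ModuleCat.of R W) := by
      refine hX.extension F1 (ModuleCat.of R W) _ f g (SES.of_exact ?_ ?_ ?_) (hX.proj _ hF1) hXq
      · rw [injective_iff_map_eq_zero]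
        rintro ⟨a, ha⟩ h
        have ha : ρ a = 0 := ha
        obtain ⟨r, hr⟩ := Submodule.mem_span_singleton.1 ((Submodule.Quotient.mk_eq_zero _).1 h)
        have hr : r • φ e = φ a := hr
        rw [← map_smul] at hr
        have h1 := hφ hr
        rw [← h1] at ha
        have h2 : r = 0 := by simpa [hρ] using ha
        refine Subtype.ext ?_
        change a = 0
        rw [← h1, h2, zero_smul]
      · intro y
        obtain ⟨y, rfl⟩ := Submodule.Quotient.mk_surjective _ y
        exact ⟨Submodule.Quotient.mk y, rfl⟩
      · intro y
        obtain ⟨y, rfl⟩ := Submodule.Quotient.mk_surjective _ y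
        constructor
        · intro h
          obtain ⟨a, rfl⟩ := (Submodule.Quotient.mk_eq_zero _).1 h
          refine ⟨⟨a - ρ a • e, by simp [hρ]⟩, ?_⟩
          refine (Submodule.Quotient.eq _).2 ?_
          refine Submodule.mem_span_singleton.2 ⟨-ρ a, ?_⟩
          simp
        · rintro ⟨a, ha⟩
          rw [← ha]
          exact (Submodule.Quotient.mk_eq_zero _).2 ⟨a, rfl⟩
    refine hX.iso hW ?_
    exact Submodule.Quotient.equiv _ _ bQ.equivFun (by
      rw [Submodule.map_span, Set.image_singleton]; rfl)
  · intro r hr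
    apply hann
    apply bQ.equivFun.injective
    rw [map_smul, map_zero]
    exact hr

end Vec
end Paper


/-- a resolving subcategory containing an eventually periodic module of
finite positive Gorenstein dimension has infinite radius. -/
theorem stmt12 (R : Type) [CommRing R] [IsNoetherianRing R] [IsLocalRing R]
    (X : ModuleCat.{0} R → Prop) (hX : Resolving R X)
    (M : ModuleCat.{0} R) (hM : X M)
    (g : ℕ) (hg : 0 < g)
    (hgd : ∃ G, IsNthSyzygy R g G M ∧ TotallyReflexive R G)
    (hgd' : ¬ ∃ G, IsNthSyzygy R (g - 1) G M ∧ TotallyReflexive R G)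
    (n t : ℕ) (hn : g ≤ n) (ht : 0 < t)
    (hper : ∃ A B : ModuleCat.{0} R, IsNthSyzygy R n A M ∧ IsNthSyzygy R (n + t) B M ∧
      Nonempty (A ≃ₗ[R] B)) :
    ¬ FiniteRadius R X := by
  obtain ⟨g, rfl⟩ := Nat.exists_eq_succ_of_ne_zero hg.ne'
  obtain ⟨G, hG, hTR⟩ := hgd
  obtain ⟨U, V, Y, F, L, F', L', j, p, j', p', hU, hV, hF, hF', hL', hs, hs', hE, ⟨e⟩⟩ :=
    chain_periodic hX hM (g+1) hG hTR n t hn ht hper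
  obtain ⟨K, hK, hGK⟩ := hG
  obtain ⟨P, i0, π, hP, hs0⟩ := hGK.ses
  have hKX := hX.nthSyz hM g K hK
  obtain ⟨A, Q, φ, hA, hQ, hφ, hns, hXq⟩ := exists_phi hX hP hU hV hF hF' hKX hL' hs0 hs hs' hE e
    (fun hext => hgd' ⟨K, hK, tr_of_extend hs0 hP hTR hext⟩)
  obtain ⟨ι, hι, v, hvm, hv, hv0⟩ := exists_vec hX φ hA hQ hφ hns hXq
  exact no_radius hX v hvm hv hv0
end
end

section
/- Let (R, m, k) be a Noetherian local ring and X a resolving subcategory of finitely generated R-modules with Ω⁻¹X ⊆ X. If Ext^1_R(M, R) = 0 for all M ∈ X, then every module of X is totally reflexive. -/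
open CategoryTheory

noncomputable section

open Paper

section aux

variable {R : Type} [CommRing R]

lemma aux_bridge (M N : ModuleCat.{0} R) (n : ℕ) :
    ExtVanish R M N (n + 1) ↔ Subsingleton (Abelian.Ext M N (n + 1)) := by
  let P := projectiveResolution M
  have h1 : ExtVanish R M N (n + 1) ↔ ∀ f : P.complex.X (n + 1) ⟶ N,
      P.complex.d (n + 2) (n + 1) ≫ f = 0 → ∃ g, P.complex.d (n + 1) n ≫ g = f := by
    unfold ExtVanish
    rw [← ModuleCat.isZero_iff_subsingleton, (P.isoExt (R := R) (n + 1) N).isZero_iff,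
      ← HomologicalComplex.exactAt_iff_isZero_homology,
      HomologicalComplex.exactAt_iff' _ n (n + 1) (n + 2) (by simp) (by simp),
      ShortComplex.moduleCat_exact_iff]
    rfl
  rw [h1]
  constructor
  · intro h
    refine subsingleton_of_forall_eq 0 fun α => ?_
    obtain ⟨f, hf, rfl⟩ := P.extMk_surjective α (n + 2) rfl
    rw [P.extMk_eq_zero_iff f (n + 2) rfl hf n rfl]
    exact h f hf
  · intro h f hf
    rw [← P.extMk_eq_zero_iff f (n + 2) rfl hf n rfl]
    exact Subsingleton.elim _ _

section ses
variable {A B C : Type} [AddCommGroup A] [AddCommGroup B] [AddCommGroup C]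
  [Module R A] [Module R B] [Module R C] {f : A →ₗ[R] B} {g : B →ₗ[R] C}

lemma aux_ses (hf : Function.Injective f) (hg : Function.Surjective g)
    (hfg : Function.Exact f g) :
    (ShortComplex.mk (ModuleCat.ofHom f) (ModuleCat.ofHom g)
      (by ext x; exact hfg.apply_apply_eq_zero x)).ShortExact where
  exact := (ShortComplex.ShortExact.moduleCat_exact_iff_function_exact _).2 hfg
  mono_f := (ModuleCat.mono_iff_injective _).2 hf
  epi_g := (ModuleCat.epi_iff_surjective _).2 hg

lemma aux_extend (hf : Function.Injective f) (hg : Function.Surjective g)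
    (hfg : Function.Exact f g) (N : ModuleCat.{0} R)
    (h : Subsingleton (Abelian.Ext (ModuleCat.of R C) N 1)) (φ : A →ₗ[R] N) :
    ∃ ψ : B →ₗ[R] N, ψ ∘ₗ f = φ := by
  obtain ⟨x, hx⟩ := Abelian.Ext.contravariant_sequence_exact₁ (aux_ses hf hg hfg) (Y := N)
    (Abelian.Ext.mk₀ (ModuleCat.ofHom φ)) (add_zero 1) (Subsingleton.elim _ _)
  obtain ⟨y, rfl⟩ := Abelian.Ext.addEquiv₀.symm.surjective x
  refine ⟨y.hom, ?_⟩
  have : Abelian.Ext.mk₀ (ModuleCat.ofHom f ≫ y) = Abelian.Ext.mk₀ (ModuleCat.ofHom φ) := by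
    rw [← hx]; simp
  have := (Abelian.Ext.mk₀_bijective _ _).1 this
  simpa using congrArg ModuleCat.Hom.hom this

lemma aux_ext_one (hf : Function.Injective f) (hg : Function.Surjective g)
    (hfg : Function.Exact f g) [Module.Projective R B] (N : ModuleCat.{0} R)
    (h : ∀ φ : A →ₗ[R] N, ∃ ψ : B →ₗ[R] N, ψ ∘ₗ f = φ) :
    Subsingleton (Abelian.Ext (ModuleCat.of R C) N 1) := by
  refine subsingleton_of_forall_eq 0 fun α => ?_
  have hB : Projective (ModuleCat.of R B) := inferInstance
  obtain ⟨x, rfl⟩ := Abelian.Ext.contravariant_sequence_exact₃ (aux_ses hf hg hfg) (Y := N) α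
    (Abelian.Ext.eq_zero_of_projective (P := ModuleCat.of R B) _) (add_zero 1)
  obtain ⟨y, rfl⟩ := Abelian.Ext.addEquiv₀.symm.surjective x
  obtain ⟨ψ, hψ⟩ := h y.hom
  have : y = ModuleCat.ofHom f ≫ ModuleCat.ofHom ψ := by
    ext x
    exact (LinearMap.congr_fun hψ x).symm
  rw [this, Abelian.Ext.addEquiv₀_symm_apply, ← Abelian.Ext.mk₀_comp_mk₀]
  exact (aux_ses hf hg hfg).extClass_comp_assoc _

lemma aux_ext_succ (hf : Function.Injective f) (hg : Function.Surjective g)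
    (hfg : Function.Exact f g) [Module.Projective R B] (N : ModuleCat.{0} R) (n : ℕ)
    (h : Subsingleton (Abelian.Ext (ModuleCat.of R A) N n)) :
    Subsingleton (Abelian.Ext (ModuleCat.of R C) N (n + 1)) := by
  refine subsingleton_of_forall_eq 0 fun α => ?_
  have hB : Projective (ModuleCat.of R B) := inferInstance
  obtain ⟨x, rfl⟩ := Abelian.Ext.contravariant_sequence_exact₃ (aux_ses hf hg hfg) (Y := N) α
    (Abelian.Ext.eq_zero_of_projective (P := ModuleCat.of R B) _) (add_comm 1 n)
  have : x = 0 := @Subsingleton.elim _ h _ _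
  rw [this, Abelian.Ext.comp_zero]
end ses

lemma aux_dual_exact {A B : Type} [AddCommGroup A] [AddCommGroup B] [Module R A] [Module R B]
    (f : A →ₗ[R] B) : Function.Exact (LinearMap.range f).mkQ.dualMap f.dualMap := by
  intro h
  constructor
  · intro h0
    refine ⟨(LinearMap.range f).liftQ h ?_, ?_⟩
    · rw [LinearMap.range_le_ker_iff]
      exact h0
    · ext x
      rfl
  · rintro ⟨c, rfl⟩
    ext x
    change c ((LinearMap.range f).mkQ (f x)) = 0
    have : (LinearMap.range f).mkQ (f x) = 0 :=
      (Submodule.Quotient.mk_eq_zero _).2 (LinearMap.mem_range_self f x)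
    rw [this, map_zero]

/-- a f.g. module all of whose `Ext` groups into `R` vanish is zero. -/
lemma aux_zero [IsNoetherianRing R] [IsLocalRing R] (L : ModuleCat.{0} R) [Module.Finite R L]
    (h : ∀ i, Subsingleton (Abelian.Ext L (ModuleCat.of R R) i)) : Subsingleton L := by
  by_contra hL
  rw [not_subsingleton_iff_nontrivial] at hL
  have hne : Module.annihilator R L ≠ ⊤ := by
    rwa [Ne, Module.annihilator_eq_top_iff, not_subsingleton_iff_nontrivial]
  have key : ∀ n : ℕ, (n : WithBot ℕ∞) ≤ ringKrullDim R := by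
    intro n
    obtain ⟨rs, hlen, -, hreg⟩ := ModuleCat.exists_isRegular_of_exists_subsingleton_ext
      (Module.annihilator R L) n (ModuleCat.of R R)
      (by simpa [lt_top_iff_ne_top] using hne) L (Module.support_eq_zeroLocus ..) (fun i _ => h i)
    have hdim := Module.supportDim_add_length_eq_supportDim_of_isRegular rs hreg
    rw [hlen] at hdim
    have h0 : (0 : WithBot ℕ∞) ≤
        Module.supportDim R (R ⧸ Ideal.ofList rs • (⊤ : Submodule R R)) := by
      have : Nontrivial (R ⧸ Ideal.ofList rs • (⊤ : Submodule R R)) :=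
        Submodule.Quotient.nontrivial_iff.2 hreg.top_ne_smul.symm
      have hb := (Module.supportDim_ne_bot_iff_nontrivial R _).2 this
      obtain ⟨d, hd⟩ := WithBot.ne_bot_iff_exists.1 hb
      rw [← hd]
      exact WithBot.coe_le_coe.2 (zero_le)
    calc (n : WithBot ℕ∞) = 0 + n := by simp
      _ ≤ _ := by gcongr
      _ = _ := hdim
      _ ≤ _ := Module.supportDim_le_ringKrullDim R _
  obtain ⟨d, hd⟩ := WithBot.ne_bot_iff_exists.1 (ringKrullDim_ne_bot (R := R))
  have hdt : d ≠ ⊤ := by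
    rintro rfl
    exact ringKrullDim_ne_top hd.symm
  obtain ⟨k, rfl⟩ := ENat.ne_top_iff_exists.1 hdt
  have hk := key (k + 1)
  rw [← hd] at hk
  have hk' : ((k + 1 : ℕ) : ℕ∞) ≤ (k : ℕ∞) := WithBot.coe_le_coe.1 hk
  have := ENat.natCast_le_natCast.1 hk'
  omega

section main
variable [IsNoetherianRing R] [IsLocalRing R] {X : ModuleCat.{0} R → Prop}

lemma aux_approx (M : ModuleCat.{0} R) [Module.Finite R M] :
    ∃ (n : ℕ) (f : M →ₗ[R] (Fin n → R)),
      IsLeftApprox R (M := M) (P := ModuleCat.of R (Fin n → R)) f := by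
  have hfin : Module.Finite R (Module.Dual R M) := by
    obtain ⟨k, g, hg⟩ := Module.Finite.exists_fin' R M
    have : IsNoetherian R (Module.Dual R (Fin k → R)) := isNoetherian_of_isNoetherianRing_of_finite R _
    exact Module.Finite.of_injective g.dualMap (LinearMap.dualMap_injective_of_surjective hg)
  obtain ⟨n, s, hs⟩ := Module.Finite.exists_fin (R := R) (M := Module.Dual R M)
  have h1 : ∀ g : M →ₗ[R] R, ∃ h : (Fin n → R) →ₗ[R] R, h ∘ₗ LinearMap.pi s = g := by
    intro g
    have hg : g ∈ Submodule.span R (Set.range s) := hs ▸ Submodule.mem_top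
    obtain ⟨c, rfl⟩ := (Submodule.mem_span_range_iff_exists_fun R).1 hg
    refine ⟨∑ i, c i • LinearMap.proj i, ?_⟩
    ext x
    simp
  refine ⟨n, LinearMap.pi s, ⟨inferInstanceAs (Module.Finite R (Fin n → R)),
    inferInstanceAs (Module.Projective R (Fin n → R))⟩, ?_⟩
  rintro Q ⟨hQ1, hQ2⟩ g
  obtain ⟨m, a, b, -, -, hab⟩ := Module.Finite.exists_comp_eq_id_of_projective R Q
  choose h hh using fun i : Fin m => h1 (LinearMap.proj i ∘ₗ b ∘ₗ g)
  refine ⟨a ∘ₗ LinearMap.pi h, ?_⟩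
  ext x
  have : (LinearMap.pi h) (LinearMap.pi s x) = b (g x) := by
    ext i
    exact LinearMap.congr_fun (hh i) x
  change a ((LinearMap.pi h) (LinearMap.pi s x)) = g x
  rw [this]
  exact LinearMap.congr_fun hab (g x)

lemma aux_free (hX : Resolving R X) (n : ℕ) : X (ModuleCat.of R (Fin n → R)) :=
  hX.proj _ ⟨inferInstanceAs (Module.Finite R (Fin n → R)),
    inferInstanceAs (Module.Projective R (Fin n → R))⟩

lemma aux_ext_all (hX : Resolving R X)
    (hext : ∀ M, X M → ExtVanish R M (ModuleCat.of R R) 1) (n : ℕ) :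
    ∀ M, X M → Subsingleton (Abelian.Ext M (ModuleCat.of R R) (n + 1)) := by
  induction n with
  | zero => exact fun M hM => (aux_bridge _ _ 0).1 (hext M hM)
  | succ n ih =>
    intro M hM
    have := hX.fg M hM
    obtain ⟨k, g, hg⟩ := Module.Finite.exists_fin' R M
    refine aux_ext_succ (f := (LinearMap.ker g).subtype) (g := g) Subtype.val_injective hg
      (LinearMap.exact_subtype_ker_map g) _ (n + 1) (ih _ ?_)
    exact hX.ker_epi _ (ModuleCat.of R (Fin k → R)) M (LinearMap.ker g).subtype g
      ⟨Subtype.val_injective, hg, by simp⟩ (aux_free hX k) hM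

lemma aux_cosyz (hX : Resolving R X)
    (hco : ∀ M, X M → ∀ N, IsCosyzygy R N M → X N)
    (hext : ∀ M, X M → ExtVanish R M (ModuleCat.of R R) 1) (M : ModuleCat.{0} R) (hM : X M) :
    ∃ (n : ℕ) (f : M →ₗ[R] (Fin n → R)), Function.Injective f ∧
      X (ModuleCat.of R ((Fin n → R) ⧸ LinearMap.range f)) ∧
      ∀ φ : M →ₗ[R] R, ∃ h : (Fin n → R) →ₗ[R] R, h ∘ₗ f = φ := by
  have := hX.fg M hM
  obtain ⟨n, f, hf⟩ := aux_approx M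
  have hC : X (ModuleCat.of R ((Fin n → R) ⧸ LinearMap.range f)) :=
    hco M hM _ ⟨ModuleCat.of R (Fin n → R), f, hf, ⟨LinearEquiv.refl R _⟩⟩
  have hφ : ∀ φ : M →ₗ[R] R, ∃ h : (Fin n → R) →ₗ[R] R, h ∘ₗ f = φ :=
    fun φ => hf.2 (ModuleCat.of R R) ⟨inferInstanceAs (Module.Finite R R),
      inferInstanceAs (Module.Projective R R)⟩ φ
  refine ⟨n, f, ?_, hC, hφ⟩
  have hK : X (ModuleCat.of R (LinearMap.range f)) :=
    hX.ker_epi _ (ModuleCat.of R (Fin n → R)) _ (LinearMap.range f).subtype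
      (LinearMap.range f).mkQ ⟨Subtype.val_injective, Submodule.mkQ_surjective _, by simp⟩
      (aux_free hX n) hC
  have hL : X (ModuleCat.of R (LinearMap.ker f)) :=
    hX.ker_epi _ M (ModuleCat.of R (LinearMap.range f)) (LinearMap.ker f).subtype
      f.rangeRestrict ⟨Subtype.val_injective, f.surjective_rangeRestrict, by simp⟩ hM hK
  have hLf := hX.fg _ hL
  have hL0 : Subsingleton (ModuleCat.of R (LinearMap.ker f)) := by
    apply aux_zero
    rintro (_ | i)
    · have hs : Subsingleton (LinearMap.ker f →ₗ[R] R) := by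
        refine subsingleton_of_forall_eq 0 fun φ => ?_
        obtain ⟨ψ, rfl⟩ := aux_extend (f := (LinearMap.ker f).subtype) (g := f.rangeRestrict)
          Subtype.val_injective f.surjective_rangeRestrict
          (LinearMap.exact_iff.2 (by simp)) (ModuleCat.of R R) (aux_ext_all hX hext 0 _ hK) φ
        obtain ⟨h, rfl⟩ := hφ ψ
        ext x
        change h (f x.1) = 0
        rw [LinearMap.mem_ker.1 x.2, map_zero]
      exact Abelian.Ext.addEquiv₀.subsingleton_congr.2
        (ModuleCat.homAddEquiv.subsingleton_congr.2 hs)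
    · exact aux_ext_all hX hext i _ hL
  rw [← LinearMap.ker_eq_bot]
  exact (Submodule.subsingleton_iff_eq_bot).1 hL0

lemma aux_inj (hX : Resolving R X)
    (hco : ∀ M, X M → ∀ N, IsCosyzygy R N M → X N)
    (hext : ∀ M, X M → ExtVanish R M (ModuleCat.of R R) 1) (M : ModuleCat.{0} R) (hM : X M) :
    Function.Injective (Module.Dual.eval R M) := by
  obtain ⟨n, f, hf, -, -⟩ := aux_cosyz hX hco hext M hM
  rw [injective_iff_map_eq_zero]
  intro x hx
  apply (injective_iff_map_eq_zero f).1 hf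
  ext i
  exact LinearMap.congr_fun hx (LinearMap.proj i ∘ₗ f)

lemma aux_bij (hX : Resolving R X)
    (hco : ∀ M, X M → ∀ N, IsCosyzygy R N M → X N)
    (hext : ∀ M, X M → ExtVanish R M (ModuleCat.of R R) 1) (M : ModuleCat.{0} R) (hM : X M) :
    Function.Bijective (Module.Dual.eval R M) := by
  refine ⟨aux_inj hX hco hext M hM, fun φ => ?_⟩
  obtain ⟨n, f, hf, hC, hfac⟩ := aux_cosyz hX hco hext M hM
  obtain ⟨p, hp⟩ := (Module.bijective_dual_eval R (Fin n → R)).2 (φ ∘ₗ f.dualMap)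
  have hp' : ∀ h : (Fin n → R) →ₗ[R] R, h p = φ (h ∘ₗ f) := fun h => LinearMap.congr_fun hp h
  have hπ : (LinearMap.range f).mkQ p = 0 := by
    apply (injective_iff_map_eq_zero _).1 (aux_inj hX hco hext _ hC)
    ext c
    have := hp' (c ∘ₗ (LinearMap.range f).mkQ)
    rw [LinearMap.comp_assoc, LinearMap.range_mkQ_comp, LinearMap.comp_zero, map_zero] at this
    exact this
  obtain ⟨m, rfl⟩ := (Submodule.Quotient.mk_eq_zero _).1 hπ
  refine ⟨m, ?_⟩
  ext ψ
  obtain ⟨h, rfl⟩ := hfac ψ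
  exact hp' h

lemma aux_ext_dual (hX : Resolving R X)
    (hco : ∀ M, X M → ∀ N, IsCosyzygy R N M → X N)
    (hext : ∀ M, X M → ExtVanish R M (ModuleCat.of R R) 1) (n : ℕ) :
    ∀ M, X M → Subsingleton
      (Abelian.Ext (ModuleCat.of R (Module.Dual R M)) (ModuleCat.of R R) (n + 1)) := by
  induction n with
  | zero =>
    intro M hM
    obtain ⟨k, f, hf, hC, hfac⟩ := aux_cosyz hX hco hext M hM
    refine aux_ext_one (f := (LinearMap.range f).mkQ.dualMap) (g := f.dualMap)
      (LinearMap.dualMap_injective_of_surjective (Submodule.mkQ_surjective _)) hfac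
      (aux_dual_exact f) _ ?_
    intro φ
    obtain ⟨c, rfl⟩ := (aux_bij hX hco hext _ hC).2 φ
    obtain ⟨p, rfl⟩ := Submodule.mkQ_surjective _ c
    exact ⟨Module.Dual.eval R _ p, rfl⟩
  | succ n ih =>
    intro M hM
    obtain ⟨k, f, hf, hC, hfac⟩ := aux_cosyz hX hco hext M hM
    exact aux_ext_succ (f := (LinearMap.range f).mkQ.dualMap) (g := f.dualMap)
      (LinearMap.dualMap_injective_of_surjective (Submodule.mkQ_surjective _)) hfac
      (aux_dual_exact f) _ (n + 1) (ih _ hC)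

end main

end aux


/-- a resolving subcategory closed under cosyzygies with `Ext^1(−,R)=0`
consists of totally reflexive modules. -/
theorem stmt15 (R : Type) [CommRing R] [IsNoetherianRing R] [IsLocalRing R]
    (X : ModuleCat.{0} R → Prop) (hX : Resolving R X)
    (hco : ∀ M, X M → ∀ N, IsCosyzygy R N M → X N)
    (hext : ∀ M, X M → ExtVanish R M (ModuleCat.of R R) 1) :
    ∀ M, X M → TotallyReflexive R M := by 
  intro M hM
  refine ⟨aux_bij hX hco hext M hM, fun i hi => ?_⟩
  obtain ⟨n, rfl⟩ : ∃ n, i = n + 1 := ⟨i - 1, by omega⟩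
  exact ⟨(aux_bridge _ _ n).2 (aux_ext_all hX hext n M hM),
    (aux_bridge _ _ n).2 (aux_ext_dual hX hco hext n M hM)⟩
end
end
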